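/- Suppose Assumptions (A1.a), (A1.b), (A2.b), (A3.a) and (A3.c) hold, and that there exist a positive integer h and a constant θ > 0 such that inf_{m≥0} λ′_m^h ≥ θ almost surely. Then the distributed estimation algorithm with random time-varying communication delays converges in mean square: for every node i = 1,…,N, lim_{k→∞} E‖x_i(k) − x_0‖² = 0. -/

import Mathlib

open MeasureTheory Filter Matrix Topology
open scoped Kronecker

/-- Spectral (2-)norm of a real matrix. -/
noncomputable def specNorm {p q : Type*} [Fintype p] [Fintype q] [DecidableEq q]
    (A : Matrix p q ℝ) : ℝ :=
  ‖LinearMap.toContinuousLinearMap (Matrix.toEuclideanLin A)‖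

/-- Smallest eigenvalue of a (symmetric) real matrix, as the infimum of the Rayleigh
quotient over the unit sphere. -/
noncomputable def lambdaMin {p : Type*} [Fintype p] (A : Matrix p p ℝ) : ℝ :=
  ⨅ x : {x : p → ℝ // ∑ i, x i ^ 2 = 1}, dotProduct x.1 (A.mulVec x.1)

/-- Entrywise conditional expectation of a random matrix. -/
noncomputable def cexpM {Ω : Type*} [MeasurableSpace Ω] (μ : Measure Ω)
    (m : MeasurableSpace Ω) {p q : Type*} (M : Ω → Matrix p q ℝ) (ω : Ω) :
    Matrix p q ℝ :=
  Matrix.of fun i j => (μ[(fun ω' => M ω' i j)|m]) ω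

/-- Degree matrix of a weighted adjacency matrix. -/
def degMat {N : ℕ} (A : Matrix (Fin N) (Fin N) ℝ) : Matrix (Fin N) (Fin N) ℝ :=
  Matrix.diagonal (fun i => ∑ j, A i j)

/-- Laplacian matrix of a weighted adjacency matrix. -/
def lapl {N : ℕ} (A : Matrix (Fin N) (Fin N) ℝ) : Matrix (Fin N) (Fin N) ℝ :=
  degMat A - A

/-- Symmetrized Laplacian `(ℒ + ℒᵀ)/2`. -/
noncomputable def symmLapl {N : ℕ} (A : Matrix (Fin N) (Fin N) ℝ) :
    Matrix (Fin N) (Fin N) ℝ :=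
  (2:ℝ)⁻¹ • (lapl A + (lapl A)ᵀ)

/-- The `Nn × Nn` matrix `ℋᵀℋ`, where `ℋ = blockdiag(H_1, …, H_N)`. -/
def blockHtH {N n : ℕ} {ni : Fin N → ℕ}
    (H : ∀ i : Fin N, Matrix (Fin (ni i)) (Fin n) ℝ) :
    Matrix (Fin N × Fin n) (Fin N × Fin n) ℝ :=
  Matrix.of fun p q => if p.1 = q.1 then ((H p.1)ᵀ * H p.1) p.2 q.2 else 0

/-- Delay matrix `𝕀(k,q)`: entry `(i,j)` is `1` if `λ_{ji}(k) = q` and `0` otherwise. -/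
def delayMat {N : ℕ} (lam : Fin N → Fin N → ℕ) (q : ℕ) : Matrix (Fin N) (Fin N) ℝ :=
  Matrix.of fun i j => if lam j i = q then 1 else 0

/-- The delay-weighted adjacency matrix `Ā(k,q) = (𝒜(k) ∘ 𝕀(k,q)) ⊗ I_n`. -/
def delayAdj {N : ℕ} (n : ℕ) (A : Matrix (Fin N) (Fin N) ℝ)
    (lam : Fin N → Fin N → ℕ) (q : ℕ) :
    Matrix (Fin N × Fin n) (Fin N × Fin n) ℝ :=
  (Matrix.hadamard A (delayMat lam q)) ⊗ₖ (1 : Matrix (Fin n) (Fin n) ℝ)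

/-- The backward matrix product `Φ_F(j,i) = F(j)F(j−1)⋯F(i)` for `j ≥ i`, and `I` for
`j < i`, for a family of square matrices indexed by `ℤ`. -/
noncomputable def phiProdZ {p : Type*} [Fintype p] [DecidableEq p]
    (F : ℤ → Matrix p p ℝ) (j i : ℤ) : Matrix p p ℝ :=
  if i ≤ j then ((List.range ((j - i).toNat + 1)).map (fun t => F (j - (t:ℤ)))).prod else 1

/-- The σ-field `ℱ(k-1) = σ(𝒜(s), v(s), H_i(s), λ_{ji}(s) : 1 ≤ i,j ≤ N, 0 ≤ s ≤ k-1)`,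
generated by the randomness strictly before time `k` (trivial for `k = 0`). -/
def sigBeforeD {Ω : Type*} {N n : ℕ} {ni : Fin N → ℕ}
    (H : ℕ → ∀ i : Fin N, Ω → Matrix (Fin (ni i)) (Fin n) ℝ)
    (v : ℕ → Ω → ∀ i : Fin N, Fin (ni i) → ℝ)
    (A : ℕ → Ω → Matrix (Fin N) (Fin N) ℝ)
    (lam : ℕ → Fin N → Fin N → Ω → ℕ) (k : ℕ) : MeasurableSpace Ω :=
  ⨆ s, ⨆ _ : s < k,
    MeasurableSpace.comap
        (fun ω (i : Fin N) (p : Fin (ni i)) (c : Fin n) => H s i ω p c) inferInstance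
    ⊔ MeasurableSpace.comap (v s) inferInstance
    ⊔ MeasurableSpace.comap (fun ω (i j : Fin N) => A s ω i j) inferInstance
    ⊔ MeasurableSpace.comap (fun ω (j i : Fin N) => lam s j i ω) inferInstance

/-- A nonnegative sequence driven by a contraction with non-summable rates and a vanishing
relative forcing term tends to zero. -/
theorem tendsto_zero_of_contraction {W α ε : ℕ → ℝ} (hW : ∀ m, 0 ≤ W m)
    (hα : ∀ᶠ m in atTop, 0 ≤ α m ∧ α m ≤ 1)
    (hsum : Tendsto (fun K => ∑ m ∈ Finset.range K, α m) atTop atTop)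
    (hε : Tendsto ε atTop (𝓝 0))
    (hrec : ∀ᶠ m in atTop, W (m + 1) ≤ (1 - α m) * W m + α m * ε m) :
    Tendsto W atTop (𝓝 0) := by
  rw [Metric.tendsto_atTop]
  intro η hη
  obtain ⟨M, hM⟩ := eventually_atTop.1
    ((hα.and hrec).and (hε.eventually (Iio_mem_nhds (show (0 : ℝ) < η / 2 by positivity))))
  have key : ∀ j, W (M + j) ≤
      η / 2 + W M * Real.exp (-(∑ m ∈ Finset.range (M + j), α m
        - ∑ m ∈ Finset.range M, α m)) := by
    intro j
    induction j with
    | zero => simp; linarith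
    | succ j ih =>
      obtain ⟨⟨⟨h0, h1⟩, h2⟩, h3⟩ := hM (M + j) (by omega)
      rw [← add_assoc, Finset.sum_range_succ]
      set S := ∑ m ∈ Finset.range (M + j), α m - ∑ m ∈ Finset.range M, α m with hS
      have e1 : -(∑ m ∈ Finset.range (M + j), α m + α (M + j) - ∑ m ∈ Finset.range M, α m)
          = -α (M + j) + -S := by rw [hS]; ring
      rw [e1, Real.exp_add]
      have h4 : 1 - α (M + j) ≤ Real.exp (-α (M + j)) := by
        have := Real.add_one_le_exp (-α (M + j)); linarith
      have h5 : 0 ≤ W M * Real.exp (-S) := mul_nonneg (hW M) (Real.exp_pos _).le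
      calc W (M + j + 1) ≤ (1 - α (M + j)) * W (M + j) + α (M + j) * ε (M + j) := h2
        _ ≤ (1 - α (M + j)) * (η / 2 + W M * Real.exp (-S)) + α (M + j) * (η / 2) := by
            gcongr
        _ = η / 2 + (1 - α (M + j)) * (W M * Real.exp (-S)) := by ring
        _ ≤ η / 2 + Real.exp (-α (M + j)) * (W M * Real.exp (-S)) := by gcongr
        _ = _ := by ring
  have hlim : Tendsto (fun K => W M * Real.exp (-(∑ m ∈ Finset.range K, α m
        - ∑ m ∈ Finset.range M, α m))) atTop (𝓝 (W M * 0)) := by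
    refine Tendsto.const_mul _ (Real.tendsto_exp_neg_atTop_nhds_zero.comp ?_)
    exact tendsto_atTop_add_const_right _ _ hsum
  rw [mul_zero] at hlim
  obtain ⟨K, hK⟩ := eventually_atTop.1
    (hlim.eventually (Iio_mem_nhds (show (0 : ℝ) < η / 2 by positivity)))
  refine ⟨max M K, fun k hk => ?_⟩
  obtain ⟨j, rfl⟩ := Nat.exists_eq_add_of_le (le_trans (le_max_left _ _) hk)
  have h1 := key j
  have h2 := hK (M + j) (le_trans (le_max_right _ _) hk)
  rw [Real.dist_eq, sub_zero, abs_of_nonneg (hW _)]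
  linarith

/-- As `tendsto_zero_of_contraction`, with rates perturbed by the decrements of a nonnegative
decreasing sequence. -/
theorem tendsto_zero_of_perturbed_contraction {V α u ε : ℕ → ℝ} (hV : ∀ m, 0 ≤ V m)
    (hα : ∀ᶠ m in atTop, 0 ≤ α m ∧ α m ≤ 1 / 2)
    (hsum : Tendsto (fun K => ∑ m ∈ Finset.range K, α m) atTop atTop)
    (hu : Antitone u) (hu0 : ∀ m, 0 ≤ u m)
    (hε : Tendsto ε atTop (𝓝 0))
    (hrec : ∀ᶠ m in atTop,
      V (m + 1) ≤ (1 - α m + (u m - u (m + 1))) * V m + α m * ε m) :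
    Tendsto V atTop (𝓝 0) := by
  have hW : Tendsto (fun m => V m * Real.exp (2 * u m)) atTop (𝓝 0) := by
    refine tendsto_zero_of_contraction (α := α) (ε := fun m => |ε m| * Real.exp (2 * u 0))
      (fun m => mul_nonneg (hV m) (Real.exp_pos _).le)
      (hα.mono fun m hm => ⟨hm.1, by linarith [hm.2]⟩) hsum ?_ ?_
    · simpa using (hε.abs).mul_const (Real.exp (2 * u 0))
    · filter_upwards [hα, hrec] with m hm hr
      have hd : 0 ≤ u m - u (m + 1) := sub_nonneg.2 (hu (Nat.le_succ m))
      set δ := u m - u (m + 1) with hδ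
      have h1 : 1 - α m + δ ≤ (1 - α m) * Real.exp (2 * δ) := by
        have := Real.add_one_le_exp (2 * δ)
        have h2 : (1 - α m) * (2 * δ + 1) ≤ (1 - α m) * Real.exp (2 * δ) :=
          mul_le_mul_of_nonneg_left this (by linarith [hm.2])
        nlinarith [hm.1, hm.2]
      have h3 : Real.exp (2 * δ) * Real.exp (2 * u (m + 1)) = Real.exp (2 * u m) := by
        rw [← Real.exp_add, hδ]; congr 1; ring
      have h4 : Real.exp (2 * u (m + 1)) ≤ Real.exp (2 * u 0) :=
        Real.exp_le_exp.2 (by linarith [hu (Nat.zero_le (m + 1))])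
      calc V (m + 1) * Real.exp (2 * u (m + 1))
          ≤ ((1 - α m + δ) * V m + α m * ε m) * Real.exp (2 * u (m + 1)) := by gcongr
        _ ≤ ((1 - α m) * Real.exp (2 * δ) * V m) * Real.exp (2 * u (m + 1))
            + α m * (|ε m| * Real.exp (2 * u 0)) := by
            rw [add_mul]
            refine add_le_add ?_ ?_
            · have := hV m
              gcongr
            · rw [mul_assoc]
              refine mul_le_mul_of_nonneg_left ?_ hm.1
              exact mul_le_mul (le_abs_self _) h4 (Real.exp_pos _).le (abs_nonneg _)
        _ = (1 - α m) * (V m * Real.exp (2 * u m)) + α m * (|ε m| * Real.exp (2 * u 0)) := by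
            rw [← h3]; ring
  refine squeeze_zero hV (fun m => ?_) hW
  have : 1 ≤ Real.exp (2 * u m) := Real.one_le_exp (by linarith [hu0 m])
  nlinarith [hV m]

/-- A delayed recursion with vanishing coefficients preserves the order of its forcing term. -/
theorem exists_le_mul_sq_of_delayed_recursion {γ a b : ℕ → ℝ} {C₁ C₂ M : ℝ} {d : ℕ}
    (ha : ∀ k, 0 < a k) (hγ : ∀ k, 0 ≤ γ k) (hC₁ : 0 ≤ C₁)
    (haM : ∀ k j, j ≤ d → a k ≤ M * a (k + j)) (hb : Tendsto b atTop (𝓝 0))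
    (hrec : ∀ k, d ≤ k →
      γ k ≤ C₁ * a k ^ 2 + C₂ * b k ^ 2 * ∑ j ∈ Finset.range d, γ (k - (j + 1))) :
    ∃ R, 0 ≤ R ∧ ∀ k, γ k ≤ R * a k ^ 2 := by
  have hlim : Tendsto (fun k => |C₂| * b k ^ 2 * (d * M ^ 2)) atTop (𝓝 0) := by
    simpa using ((hb.pow 2).const_mul |C₂|).mul_const (d * M ^ 2)
  obtain ⟨K, hK⟩ := eventually_atTop.1
    (hlim.eventually (Iio_mem_nhds (show (0 : ℝ) < 1 / 2 by norm_num)))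
  set R := 2 * C₁ + ∑ j ∈ Finset.range (max K d), γ j / a j ^ 2 with hR
  have hsum : 0 ≤ ∑ j ∈ Finset.range (max K d), γ j / a j ^ 2 :=
    Finset.sum_nonneg fun j _ => div_nonneg (hγ j) (sq_nonneg _)
  have hR0 : 0 ≤ R := by linarith
  refine ⟨R, hR0, fun k => ?_⟩
  induction k using Nat.strong_induction_on with
  | _ k ih =>
    by_cases hk : k < max K d
    · have h1 : γ k / a k ^ 2 ≤ R := by
        have := Finset.single_le_sum (f := fun j => γ j / a j ^ 2)
          (fun j _ => div_nonneg (hγ j) (sq_nonneg _)) (Finset.mem_range.2 hk)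
        linarith
      exact (div_le_iff₀ (pow_pos (ha k) 2)).1 h1
    · push Not at hk
      have hdk : d ≤ k := le_trans (le_max_right _ _) hk
      have h1 := hrec k hdk
      have h2 : ∑ j ∈ Finset.range d, γ (k - (j + 1)) ≤ d * (R * (M * a k) ^ 2) := by
        calc ∑ j ∈ Finset.range d, γ (k - (j + 1))
            ≤ ∑ j ∈ Finset.range d, R * (M * a k) ^ 2 := by
              refine Finset.sum_le_sum fun j hj => ?_
              have hj' := Finset.mem_range.1 hj
              refine (ih (k - (j + 1)) (by omega)).trans ?_
              have h3 := haM (k - (j + 1)) (j + 1) (by omega)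
              rw [Nat.sub_add_cancel (by omega)] at h3
              have := (ha (k - (j + 1))).le
              gcongr
          _ = _ := by simp
      have h4 := hK k (le_trans (le_max_left _ _) hk)
      have hS0 : 0 ≤ ∑ j ∈ Finset.range d, γ (k - (j + 1)) :=
        Finset.sum_nonneg fun j _ => hγ _
      calc γ k ≤ C₁ * a k ^ 2 + C₂ * b k ^ 2 * ∑ j ∈ Finset.range d, γ (k - (j + 1)) := h1
        _ ≤ C₁ * a k ^ 2 + |C₂| * b k ^ 2 * (d * (R * (M * a k) ^ 2)) := by
            gcongr
            exact le_abs_self _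
        _ = C₁ * a k ^ 2 + (|C₂| * b k ^ 2 * (d * M ^ 2)) * (R * a k ^ 2) := by ring
        _ ≤ C₁ * a k ^ 2 + 1 / 2 * (R * a k ^ 2) := by gcongr
        _ ≤ R * a k ^ 2 := by nlinarith [sq_nonneg (a k)]

section BlockEstimate

variable {E : Type*} [NormedAddCommGroup E] [InnerProductSpace ℝ E]

/-- Over a bounded number of steps of a perturbed near-identity linear recursion, the state moves
by at most a multiple of the step size times its initial norm plus the total perturbation. -/
theorem norm_sub_initial_le {e g : ℕ → E} {G : ℕ → E →L[ℝ] E} {β B Γ : ℝ} {h : ℕ}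
    (hβ : 0 ≤ β) (hβB : β ≤ B) (hΓ : 0 ≤ Γ) (hG : ∀ j < h, ‖G j‖ ≤ β)
    (hg : ∀ j < h, ‖g j‖ ≤ Γ) (hrec : ∀ j < h, e (j + 1) = e j - G j (e j) + g j) :
    ∀ j ≤ h, ‖e j - e 0‖ ≤ (2 + B) ^ j * (β * ‖e 0‖ + Γ) := by
  intro j
  induction j with
  | zero =>
    intro _
    simpa using by positivity
  | succ j ih =>
    intro hj
    have hj' : j < h := hj
    have h1 := ih hj'.le
    set t := β * ‖e 0‖ + Γ with ht
    have hB : 0 ≤ B := hβ.trans hβB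
    have ht0 : 0 ≤ t := by positivity
    have h2 : ‖G j (e j)‖ ≤ β * ‖e 0‖ + B * ‖e j - e 0‖ := by
      calc ‖G j (e j)‖ ≤ ‖G j‖ * ‖e j‖ := (G j).le_opNorm _
        _ ≤ β * ‖e 0 + (e j - e 0)‖ := by
            rw [add_sub_cancel]; exact mul_le_mul_of_nonneg_right (hG j hj') (norm_nonneg _)
        _ ≤ β * (‖e 0‖ + ‖e j - e 0‖) := by gcongr; exact norm_add_le _ _
        _ ≤ _ := by rw [mul_add]; gcongr
    have h3 : e (j + 1) - e 0 = (e j - e 0) - G j (e j) + g j := by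
      rw [hrec j hj']; abel
    have hp : (1 : ℝ) ≤ (2 + B) ^ j := one_le_pow₀ (by linarith)
    calc ‖e (j + 1) - e 0‖ ≤ ‖e j - e 0‖ + ‖G j (e j)‖ + ‖g j‖ := by
          rw [h3]; exact (norm_add_le _ _).trans (by gcongr; exact norm_sub_le _ _)
      _ ≤ ‖e j - e 0‖ + (β * ‖e 0‖ + B * ‖e j - e 0‖) + Γ := by gcongr; exact hg j hj'
      _ = (1 + B) * ‖e j - e 0‖ + t := by rw [ht]; ring
      _ ≤ (1 + B) * ((2 + B) ^ j * t) + (2 + B) ^ j * t := by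
          gcongr
          nlinarith
      _ = (2 + B) ^ (j + 1) * t := by ring

/-- One-block energy estimate for a perturbed near-identity linear recursion whose perturbation
splits into a driving part `w` and a part of relative size `β`. -/
theorem norm_sq_block_le {e g w : ℕ → E} {G : ℕ → E →L[ℝ] E} {β B Γ : ℝ} {h : ℕ}
    (hβ : 0 ≤ β) (hβB : β ≤ B) (hΓ : 0 ≤ Γ) (hG : ∀ j < h, ‖G j‖ ≤ β)
    (hg : ∀ j < h, ‖g j‖ ≤ Γ) (hgw : ∀ j < h, ‖g j - w j‖ ≤ β * Γ)
    (hrec : ∀ j < h, e (j + 1) = e j - G j (e j) + g j) :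
    ‖e h‖ ^ 2 ≤ ‖e 0‖ ^ 2 - 2 * ∑ j ∈ Finset.range h, inner ℝ (e 0) (G j (e 0))
      + 2 * ∑ j ∈ Finset.range h, inner ℝ (e 0) (w j)
      + 2 * (2 * h + 2 * h * (2 + B) ^ h + ((2 + B) ^ h) ^ 2) * ((β * ‖e 0‖) ^ 2 + Γ ^ 2) := by
  have hB : 0 ≤ B := hβ.trans hβB
  set t := β * ‖e 0‖ + Γ with ht
  set c := (2 + B) ^ h with hc
  have ht0 : 0 ≤ t := by positivity
  have hc0 : 0 ≤ c := by positivity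
  have hmove : ∀ j ≤ h, ‖e j - e 0‖ ≤ c * t := fun j hj =>
    (norm_sub_initial_le hβ hβB hΓ hG hg hrec j hj).trans
      (mul_le_mul_of_nonneg_right (pow_le_pow_right₀ (by linarith) hj) ht0)
  have htel : ∀ j ≤ h, e j - e 0 = ∑ i ∈ Finset.range j, (g i - G i (e i)) := by
    intro j
    induction j with
    | zero => simp
    | succ j ih =>
      intro hj
      rw [Finset.sum_range_succ, ← ih (by omega), hrec j hj]
      abel
  have hinner : inner ℝ (e 0) (e h - e 0) ≤
      -∑ j ∈ Finset.range h, inner ℝ (e 0) (G j (e 0))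
      + ∑ j ∈ Finset.range h, inner ℝ (e 0) (w j) + h * (t ^ 2 + c * t ^ 2) := by
    rw [htel h le_rfl, inner_sum, ← Finset.sum_neg_distrib, ← Finset.sum_add_distrib]
    have hconst : h * (t ^ 2 + c * t ^ 2) = ∑ j ∈ Finset.range h, (t ^ 2 + c * t ^ 2) := by
      simp [mul_add]
    rw [hconst, ← Finset.sum_add_distrib]
    refine Finset.sum_le_sum fun j hj => ?_
    have hj' := Finset.mem_range.1 hj
    have e1 : g j - G j (e j) = (g j - w j) + w j - G j (e 0) - G j (e j - e 0) := by
      rw [map_sub]; abel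
    rw [e1, inner_sub_right, inner_sub_right, inner_add_right]
    have h1 : inner ℝ (e 0) (g j - w j) ≤ t ^ 2 := by
      calc inner ℝ (e 0) (g j - w j) ≤ ‖e 0‖ * ‖g j - w j‖ := real_inner_le_norm _ _
        _ ≤ ‖e 0‖ * (β * Γ) := by gcongr; exact hgw j hj'
        _ = (β * ‖e 0‖) * Γ := by ring
        _ ≤ t * t := by
            gcongr
            · linarith
            · have : 0 ≤ β * ‖e 0‖ := by positivity
              linarith
        _ = t ^ 2 := by ring
    have h2 : -inner ℝ (e 0) (G j (e j - e 0)) ≤ c * t ^ 2 := by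
      calc -inner ℝ (e 0) (G j (e j - e 0)) ≤ ‖e 0‖ * ‖G j (e j - e 0)‖ :=
            (neg_le_abs _).trans (abs_real_inner_le_norm _ _)
        _ ≤ ‖e 0‖ * (β * (c * t)) := by
            gcongr
            refine ((G j).le_opNorm _).trans ?_
            gcongr
            · exact hG j hj'
            · exact hmove j hj'.le
        _ = (β * ‖e 0‖) * (c * t) := by ring
        _ ≤ t * (c * t) := by gcongr; linarith
        _ = c * t ^ 2 := by ring
    linarith
  have hexp : ‖e h‖ ^ 2 = ‖e 0‖ ^ 2 + 2 * inner ℝ (e 0) (e h - e 0) + ‖e h - e 0‖ ^ 2 := by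
    rw [← norm_add_sq_real, add_sub_cancel]
  have hsq : ‖e h - e 0‖ ^ 2 ≤ c ^ 2 * t ^ 2 := by
    rw [← mul_pow]
    exact pow_le_pow_left₀ (norm_nonneg _) (hmove h le_rfl) 2
  have ht2 : t ^ 2 ≤ 2 * ((β * ‖e 0‖) ^ 2 + Γ ^ 2) := by
    rw [ht]; nlinarith [sq_nonneg (β * ‖e 0‖ - Γ)]
  have hfin : (2 * h + 2 * h * c + c ^ 2) * t ^ 2 ≤
      (2 * h + 2 * h * c + c ^ 2) * (2 * ((β * ‖e 0‖) ^ 2 + Γ ^ 2)) := by gcongr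
  rw [hexp]
  linarith

end BlockEstimate

section DelayElimination

variable {ι : Type*} [Fintype ι] [DecidableEq ι]

theorem isUnit_of_norm_one_sub_le {F : Matrix ι ι ℝ} {κ : ℝ} (hκ : κ < 1)
    (hF : ‖toEuclideanCLM (n := ι) (𝕜 := ℝ) (1 - F)‖ ≤ κ) : IsUnit F := by
  have h1 : IsUnit (toEuclideanCLM (n := ι) (𝕜 := ℝ) F) := by
    have := isUnit_one_sub_of_norm_lt_one (hF.trans_lt hκ)
    rwa [map_sub, map_one, sub_sub_cancel] at this
  exact (MulEquiv.isUnit_map (toEuclideanCLM (n := ι) (𝕜 := ℝ))).1 h1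

theorem norm_toEuclideanCLM_inv_le {F : Matrix ι ι ℝ} {κ : ℝ} (hκ : κ < 1)
    (hF : ‖toEuclideanCLM (n := ι) (𝕜 := ℝ) (1 - F)‖ ≤ κ) :
    ‖toEuclideanCLM (n := ι) (𝕜 := ℝ) F⁻¹‖ ≤ (1 - κ)⁻¹ := by
  have hu := (Matrix.isUnit_iff_isUnit_det F).1 (isUnit_of_norm_one_sub_le hκ hF)
  have h1 : 0 < 1 - κ := by linarith
  refine ContinuousLinearMap.opNorm_le_bound _ (inv_nonneg.2 h1.le) fun z => ?_
  set y := toEuclideanCLM (n := ι) (𝕜 := ℝ) F⁻¹ z with hy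
  have hz : z = y - toEuclideanCLM (n := ι) (𝕜 := ℝ) (1 - F) y := by
    have : toEuclideanCLM (n := ι) (𝕜 := ℝ) F y = z := by
      rw [hy, ← mul_apply_eq_comp, ← map_mul, Matrix.mul_nonsing_inv F hu, map_one,
        one_apply_eq_self]
    rw [map_sub, map_one, _root_.sub_apply, one_apply_eq_self, this]
    abel
  have h2 : (1 - κ) * ‖y‖ ≤ ‖z‖ := by
    have h3 : ‖toEuclideanCLM (n := ι) (𝕜 := ℝ) (1 - F) y‖ ≤ κ * ‖y‖ :=
      (ContinuousLinearMap.le_opNorm _ _).trans (by gcongr)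
    have h4 := norm_sub_norm_le y (toEuclideanCLM (n := ι) (𝕜 := ℝ) (1 - F) y)
    rw [← hz] at h4
    linarith
  rw [inv_mul_eq_div, le_div_iff₀ h1]
  linarith

theorem phiProdZ_eq_prod (F : ℤ → Matrix ι ι ℝ) (k : ℤ) (q : ℕ) :
    phiProdZ F (k - 1) (k - q) = ((List.range q).map fun t : ℕ => F (k - ((t : ℤ) + 1))).prod := by
  unfold phiProdZ
  rcases Nat.eq_zero_or_pos q with rfl | hq
  · simp
  · rw [if_pos (by omega), show (k - 1 - (k - (q : ℤ))).toNat + 1 = q by omega]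
    simp only [sub_sub, add_comm (1 : ℤ), bind_pure_comp, List.map_eq_map, List.map_map]
    rfl

theorem phiProdZ_inv_zero (F : ℤ → Matrix ι ι ℝ) (k : ℤ) :
    (phiProdZ F (k - 1) (k - (0 : ℕ)))⁻¹ = 1 := by
  rw [phiProdZ_eq_prod]; simp

theorem phiProdZ_inv_succ (F : ℤ → Matrix ι ι ℝ) (k : ℤ) (q : ℕ) :
    (phiProdZ F (k - 1) (k - (q + 1 : ℕ)))⁻¹ =
      (F (k - (q + 1)))⁻¹ * (phiProdZ F (k - 1) (k - q))⁻¹ := by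
  rw [phiProdZ_eq_prod, phiProdZ_eq_prod, List.range_succ, List.map_append, List.prod_append,
    Matrix.mul_inv_rev]
  simp

theorem norm_phiProdZ_inv_le {F : ℤ → Matrix ι ι ℝ} {κ : ℝ} (hκ : κ < 1) {k : ℤ} {q : ℕ}
    (hF : ∀ j : ℕ, j < q → ‖toEuclideanCLM (n := ι) (𝕜 := ℝ) (1 - F (k - (j + 1)))‖ ≤ κ) :
    ‖toEuclideanCLM (n := ι) (𝕜 := ℝ) (phiProdZ F (k - 1) (k - q))⁻¹‖ ≤ (1 - κ)⁻¹ ^ q := by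
  induction q with
  | zero =>
    rw [phiProdZ_inv_zero, map_one, pow_zero]
    exact ContinuousLinearMap.norm_id_le
  | succ q ih =>
    rw [phiProdZ_inv_succ, map_mul, pow_succ']
    refine (norm_mul_le _ _).trans ?_
    have h1 : (0 : ℝ) ≤ (1 - κ)⁻¹ := inv_nonneg.2 (by linarith)
    exact mul_le_mul (norm_toEuclideanCLM_inv_le hκ (hF q (Nat.lt_succ_self q)))
      (ih fun j hj => hF j (by omega)) (norm_nonneg _) h1

/-- Backward reconstruction of the past states of a perturbed linear recursion. -/
theorem norm_phiProdZ_inv_apply_sub_le {F : ℤ → Matrix ι ι ℝ} {κ : ℝ} (hκ0 : 0 ≤ κ)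
    (hκ : κ < 1) {e : ℤ → EuclideanSpace ℝ ι} {k : ℤ} {q : ℕ}
    (hF : ∀ j : ℕ, j < q → ‖toEuclideanCLM (n := ι) (𝕜 := ℝ) (1 - F (k - (j + 1)))‖ ≤ κ) :
    ‖toEuclideanCLM (n := ι) (𝕜 := ℝ) (phiProdZ F (k - 1) (k - q))⁻¹ (e k) - e (k - q)‖ ≤
      (1 - κ)⁻¹ ^ q * ∑ j ∈ Finset.range q,
        ‖e (k - (j + 1) + 1) - toEuclideanCLM (n := ι) (𝕜 := ℝ) (F (k - (j + 1))) (e (k - (j + 1)))‖ := by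
  induction q with
  | zero => rw [phiProdZ_inv_zero]; simp
  | succ q ih =>
    have hFq := hF q (Nat.lt_succ_self q)
    have hu := (Matrix.isUnit_iff_isUnit_det _).1 (isUnit_of_norm_one_sub_le hκ hFq)
    have ih' := ih fun j hj => hF j (by omega)
    have h1 : (1 : ℝ) ≤ (1 - κ)⁻¹ := (one_le_inv₀ (by linarith)).2 (by linarith)
    set ρ := (1 - κ)⁻¹
    set F' := F (k - (q + 1))
    set r := toEuclideanCLM (n := ι) (𝕜 := ℝ) (phiProdZ F (k - 1) (k - q))⁻¹ (e k) - e (k - q) with hr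
    set g := e (k - (q + 1) + 1) - toEuclideanCLM (n := ι) (𝕜 := ℝ) F' (e (k - (q + 1))) with hg
    have hkey : toEuclideanCLM (n := ι) (𝕜 := ℝ) (phiProdZ F (k - 1) (k - (q + 1 : ℕ)))⁻¹ (e k)
        - e (k - (q + 1 : ℕ)) = toEuclideanCLM (n := ι) (𝕜 := ℝ) F'⁻¹ (g + r) := by
      have e1 : k - (q + 1 : ℤ) + 1 = k - q := by ring
      have e2 : g + r = toEuclideanCLM (n := ι) (𝕜 := ℝ) (phiProdZ F (k - 1) (k - q))⁻¹ (e k)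
          - toEuclideanCLM (n := ι) (𝕜 := ℝ) F' (e (k - (q + 1))) := by
        rw [hg, hr, e1]; abel
      rw [e2, map_sub, phiProdZ_inv_succ, map_mul, mul_apply_eq_comp,
        ← mul_apply_eq_comp, ← mul_apply_eq_comp, ← map_mul, ← map_mul,
        Matrix.nonsing_inv_mul _ hu, map_one, one_apply_eq_self]
      push_cast
      rw [map_mul, mul_apply_eq_comp]
    rw [hkey, Finset.sum_range_succ]
    have hρ : (1 : ℝ) ≤ ρ ^ q := one_le_pow₀ h1
    set S := ∑ j ∈ Finset.range q,
        ‖e (k - (j + 1) + 1) - toEuclideanCLM (n := ι) (𝕜 := ℝ) (F (k - (j + 1))) (e (k - (j + 1)))‖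
    calc ‖toEuclideanCLM (n := ι) (𝕜 := ℝ) F'⁻¹ (g + r)‖ ≤ ρ * ‖g + r‖ :=
          (ContinuousLinearMap.le_opNorm _ _).trans
            (mul_le_mul_of_nonneg_right (norm_toEuclideanCLM_inv_le hκ hFq) (norm_nonneg _))
      _ ≤ ρ * (ρ ^ q * ‖g‖ + ρ ^ q * S) := by
          gcongr
          refine (norm_add_le _ _).trans (add_le_add ?_ ih')
          exact le_mul_of_one_le_left (norm_nonneg _) hρ
      _ = ρ ^ (q + 1) * (S + ‖g‖) := by ring

variable {F : ℤ → Matrix ι ι ℝ} {P : ℕ → Matrix ι ι ℝ} {Q : ℕ → ℕ → Matrix ι ι ℝ}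
  {b : ℕ → ℝ} {d : ℕ} {κ cP cQ : ℝ}

theorem norm_delay_sum_le (hκ : κ < 1) (hQ : ∀ k q, ‖toEuclideanCLM (n := ι) (𝕜 := ℝ) (Q k q)‖ ≤ cQ)
    {k : ℕ}
    (hF : ∀ j : ℕ, j < d → ‖toEuclideanCLM (n := ι) (𝕜 := ℝ) (1 - F ((k : ℤ) - (j + 1)))‖ ≤ κ) :
    ‖toEuclideanCLM (n := ι) (𝕜 := ℝ) (∑ q ∈ Finset.range (d + 1),
      Q k q * (phiProdZ F ((k : ℤ) - 1) ((k : ℤ) - q))⁻¹)‖ ≤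
      cQ * ∑ q ∈ Finset.range (d + 1), (1 - κ)⁻¹ ^ q := by
  rw [map_sum, Finset.mul_sum]
  refine (norm_sum_le _ _).trans (Finset.sum_le_sum fun q hq => ?_)
  have hq' := Finset.mem_range.1 hq
  rw [map_mul]
  refine (norm_mul_le _ _).trans ?_
  exact mul_le_mul (hQ k q) (norm_phiProdZ_inv_le hκ fun j hj => hF j (by omega))
    (norm_nonneg _) ((norm_nonneg _).trans (hQ k q))

/-- The delay-elimination matrices are uniformly close to the identity. -/
theorem norm_one_sub_le_of_delay_recursion (hκ0 : 0 ≤ κ) (hκ : κ < 1) (hb : ∀ k, 0 ≤ b k)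
    (hstart : ∀ k : ℤ, -(d : ℤ) ≤ k → k ≤ -1 → F k = 1)
    (hrec : ∀ k : ℕ, F k = 1 - (P k - b k • ∑ q ∈ Finset.range (d + 1),
      Q k q * (phiProdZ F ((k : ℤ) - 1) ((k : ℤ) - q))⁻¹))
    (hP : ∀ k, ‖toEuclideanCLM (n := ι) (𝕜 := ℝ) (P k)‖ ≤ b k * cP)
    (hQ : ∀ k q, ‖toEuclideanCLM (n := ι) (𝕜 := ℝ) (Q k q)‖ ≤ cQ)
    (hbP : ∀ k, b k * cP ≤ κ / 2)
    (hbQ : ∀ k, b k * (cQ * ∑ q ∈ Finset.range (d + 1), (1 - κ)⁻¹ ^ q) ≤ κ / 2) :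
    (∀ k : ℤ, -(d : ℤ) ≤ k → ‖toEuclideanCLM (n := ι) (𝕜 := ℝ) (1 - F k)‖ ≤ κ) ∧
    ∀ k : ℕ, ‖toEuclideanCLM (n := ι) (𝕜 := ℝ) (1 - F k)‖ ≤
      (cP + cQ * ∑ q ∈ Finset.range (d + 1), (1 - κ)⁻¹ ^ q) * b k := by
  have hstep : ∀ k : ℕ,
      (∀ j : ℕ, j < d → ‖toEuclideanCLM (n := ι) (𝕜 := ℝ) (1 - F ((k : ℤ) - (j + 1)))‖ ≤ κ) →
      ‖toEuclideanCLM (n := ι) (𝕜 := ℝ) (1 - F k)‖ ≤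
        b k * cP + b k * (cQ * ∑ q ∈ Finset.range (d + 1), (1 - κ)⁻¹ ^ q) := by
    intro k hk
    rw [hrec k, sub_sub_cancel, map_sub, map_smul]
    refine (norm_sub_le _ _).trans (add_le_add (hP k) ?_)
    rw [norm_smul, Real.norm_of_nonneg (hb k)]
    exact mul_le_mul_of_nonneg_left (norm_delay_sum_le hκ hQ hk) (hb k)
  have hall : ∀ k : ℕ, ∀ s : ℤ, -(d : ℤ) ≤ s → s < k →
      ‖toEuclideanCLM (n := ι) (𝕜 := ℝ) (1 - F s)‖ ≤ κ := by
    intro k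
    induction k with
    | zero =>
      intro s h1 h2
      rw [hstart s h1 (by push_cast at h2; omega)]
      simpa using hκ0
    | succ k ih =>
      intro s h1 h2
      rcases lt_or_eq_of_le (show s ≤ k by push_cast at h2; omega) with h3 | h3
      · exact ih s h1 h3
      · subst h3
        refine (hstep k fun j hj => ih _ (by omega) (by omega)).trans ?_
        linarith [hbP k, hbQ k]
  have hbound : ∀ k : ℤ, -(d : ℤ) ≤ k → ‖toEuclideanCLM (n := ι) (𝕜 := ℝ) (1 - F k)‖ ≤ κ :=
    fun k hk => hall (k.toNat + 1) k hk (by omega)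
  refine ⟨hbound, fun k => (hstep k fun j hj => hbound _ (by omega)).trans (le_of_eq (by ring))⟩

/-- The defect of the delayed recursion with respect to the delay-free one is the driving term up
to a small combination of the previous defects. -/
theorem norm_defect_sub_le (hκ0 : 0 ≤ κ) (hκ : κ < 1) (hb : ∀ k, 0 ≤ b k)
    (hrec : ∀ k : ℕ, F k = 1 - (P k - b k • ∑ q ∈ Finset.range (d + 1),
      Q k q * (phiProdZ F ((k : ℤ) - 1) ((k : ℤ) - q))⁻¹))
    (hQ : ∀ k q, ‖toEuclideanCLM (n := ι) (𝕜 := ℝ) (Q k q)‖ ≤ cQ)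
    (hF : ∀ k : ℤ, -(d : ℤ) ≤ k → ‖toEuclideanCLM (n := ι) (𝕜 := ℝ) (1 - F k)‖ ≤ κ)
    {e : ℤ → EuclideanSpace ℝ ι} {w : EuclideanSpace ℝ ι} {k : ℕ}
    (he : e ((k : ℤ) + 1) = e k - toEuclideanCLM (n := ι) (𝕜 := ℝ) (P k) (e k)
      + b k • ∑ q ∈ Finset.range (d + 1),
        toEuclideanCLM (n := ι) (𝕜 := ℝ) (Q k q) (e ((k : ℤ) - q)) + w) :
    ‖e ((k : ℤ) + 1) - toEuclideanCLM (n := ι) (𝕜 := ℝ) (F k) (e k) - w‖ ≤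
      b k * (cQ * ∑ q ∈ Finset.range (d + 1), (1 - κ)⁻¹ ^ q) *
        ∑ j ∈ Finset.range d, ‖e ((k : ℤ) - (j + 1) + 1) -
          toEuclideanCLM (n := ι) (𝕜 := ℝ) (F ((k : ℤ) - (j + 1))) (e ((k : ℤ) - (j + 1)))‖ := by
  set S := ∑ j ∈ Finset.range d, ‖e ((k : ℤ) - (j + 1) + 1) -
          toEuclideanCLM (n := ι) (𝕜 := ℝ) (F ((k : ℤ) - (j + 1))) (e ((k : ℤ) - (j + 1)))‖ with hS
  have h1 : e ((k : ℤ) + 1) - toEuclideanCLM (n := ι) (𝕜 := ℝ) (F k) (e k) - w =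
      -(b k • ∑ q ∈ Finset.range (d + 1), toEuclideanCLM (n := ι) (𝕜 := ℝ) (Q k q)
        (toEuclideanCLM (n := ι) (𝕜 := ℝ) (phiProdZ F ((k : ℤ) - 1) ((k : ℤ) - q))⁻¹ (e k)
          - e ((k : ℤ) - q))) := by
    rw [he, hrec k]
    simp only [map_sub, map_one, map_smul, map_sum, map_mul, _root_.sub_apply,
      one_apply_eq_self, _root_.smul_apply,
      _root_.sum_apply, mul_apply_eq_comp, Finset.sum_sub_distrib,
      smul_sub]
    abel
  have hcQ : 0 ≤ cQ := (norm_nonneg _).trans (hQ 0 0)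
  have hρ : (0 : ℝ) ≤ (1 - κ)⁻¹ := inv_nonneg.2 (by linarith)
  rw [h1, norm_neg, norm_smul, Real.norm_of_nonneg (hb k), mul_assoc]
  refine mul_le_mul_of_nonneg_left ?_ (hb k)
  rw [Finset.mul_sum _ _ cQ, Finset.sum_mul]
  refine (norm_sum_le _ _).trans (Finset.sum_le_sum fun q hq => ?_)
  have hq' := Finset.mem_range.1 hq
  rw [mul_assoc]
  refine (ContinuousLinearMap.le_opNorm _ _).trans
    (mul_le_mul (hQ k q) ?_ (norm_nonneg _) hcQ)
  refine (norm_phiProdZ_inv_apply_sub_le hκ0 hκ fun j hj => hF _ (by omega)).trans ?_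
  refine mul_le_mul_of_nonneg_left ?_ (pow_nonneg hρ q)
  exact Finset.sum_le_sum_of_subset_of_nonneg
    (Finset.range_subset_range.2 (by omega)) fun _ _ _ => norm_nonneg _

end DelayElimination

section MatrixBounds

theorem norm_toEuclideanCLM_le_of_sq {ι : Type*} [Fintype ι] [DecidableEq ι]
    {M : Matrix ι ι ℝ} {c : ℝ} (hc : 0 ≤ c)
    (hM : ∀ y : ι → ℝ, ∑ i, (M *ᵥ y) i ^ 2 ≤ c ^ 2 * ∑ i, y i ^ 2) :
    ‖toEuclideanCLM (n := ι) (𝕜 := ℝ) M‖ ≤ c := by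
  refine ContinuousLinearMap.opNorm_le_bound _ hc fun y => ?_
  refine abs_le_of_sq_le_sq' ?_ (by positivity) |>.2
  rw [mul_pow, EuclideanSpace.real_norm_sq_eq, EuclideanSpace.real_norm_sq_eq]
  exact hM y

section SpecNorm

open scoped Matrix.Norms.L2Operator

variable {p q : Type*} [Fintype p] [Fintype q] [DecidableEq q]

theorem specNorm_eq_norm (A : Matrix p q ℝ) : specNorm A = ‖A‖ := rfl

theorem specNorm_transpose [DecidableEq p] (A : Matrix p q ℝ) : specNorm Aᵀ = specNorm A := by
  rw [specNorm_eq_norm, specNorm_eq_norm, ← conjTranspose_eq_transpose_of_trivial,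
    l2_opNorm_conjTranspose]

theorem sum_mulVec_sq_le {A : Matrix p q ℝ} {β : ℝ} (hA : specNorm A ≤ β) (y : q → ℝ) :
    ∑ i, (A *ᵥ y) i ^ 2 ≤ β ^ 2 * ∑ i, y i ^ 2 := by
  have h1 := (l2_opNorm_mulVec A (WithLp.toLp 2 y)).trans
    (mul_le_mul_of_nonneg_right hA (norm_nonneg _))
  have h2 := pow_le_pow_left₀ (norm_nonneg _) h1 2
  rw [mul_pow, EuclideanSpace.real_norm_sq_eq, EuclideanSpace.real_norm_sq_eq] at h2
  exact h2

end SpecNorm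

variable {N n : ℕ} {ni : Fin N → ℕ}

theorem kronecker_one_mulVec (M : Matrix (Fin N) (Fin N) ℝ) (y : Fin N × Fin n → ℝ)
    (i : Fin N) (c : Fin n) :
    ((M ⊗ₖ (1 : Matrix (Fin n) (Fin n) ℝ)) *ᵥ y) (i, c) = ∑ j, M i j * y (j, c) := by
  simp [mulVec, dotProduct, Fintype.sum_prod_type, Matrix.one_apply]

theorem blockHtH_mulVec (H : ∀ i : Fin N, Matrix (Fin (ni i)) (Fin n) ℝ)
    (y : Fin N × Fin n → ℝ) (i : Fin N) (c : Fin n) :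
    (blockHtH H *ᵥ y) (i, c) = ((H i)ᵀ *ᵥ (H i *ᵥ fun c' => y (i, c'))) c := by
  rw [mulVec_mulVec]
  simp only [blockHtH, mulVec, dotProduct, Fintype.sum_prod_type, of_apply, ite_mul, zero_mul]
  rw [Finset.sum_eq_single i]
  · simp
  · intro j _ hj
    simp [Ne.symm hj]
  · simp

theorem norm_kronecker_one_le {M : Matrix (Fin N) (Fin N) ℝ} {β : ℝ} (hβ : 0 ≤ β)
    (hM : ∀ i j, |M i j| ≤ β) :
    ‖toEuclideanCLM (n := Fin N × Fin n) (𝕜 := ℝ) (M ⊗ₖ (1 : Matrix (Fin n) (Fin n) ℝ))‖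
      ≤ N * β := by
  refine norm_toEuclideanCLM_le_of_sq (by positivity) fun y => ?_
  rw [Fintype.sum_prod_type, Fintype.sum_prod_type]
  simp only [kronecker_one_mulVec]
  have h1 : ∀ i c, (∑ j, M i j * y (j, c)) ^ 2 ≤ N * β ^ 2 * ∑ j, y (j, c) ^ 2 := by
    intro i c
    refine (Finset.sum_mul_sq_le_sq_mul_sq _ _ _).trans ?_
    refine mul_le_mul_of_nonneg_right ?_ (Finset.sum_nonneg fun _ _ => sq_nonneg _)
    calc ∑ j, M i j ^ 2 ≤ ∑ _j : Fin N, β ^ 2 :=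
          Finset.sum_le_sum fun j _ => sq_le_sq' (neg_le_of_abs_le (hM i j))
            (le_of_abs_le (hM i j))
      _ = N * β ^ 2 := by simp
  calc ∑ i, ∑ c, (∑ j, M i j * y (j, c)) ^ 2
      ≤ ∑ _i : Fin N, ∑ c, N * β ^ 2 * ∑ j, y (j, c) ^ 2 :=
        Finset.sum_le_sum fun i _ => Finset.sum_le_sum fun c _ => h1 i c
    _ = (N * β) ^ 2 * ∑ j, ∑ c, y (j, c) ^ 2 := by
        rw [Finset.sum_const, ← Finset.mul_sum, Finset.sum_comm]
        simp
        ring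

theorem norm_degMat_kronecker_le {A : Matrix (Fin N) (Fin N) ℝ} {β : ℝ} (hβ : 0 ≤ β)
    (hA : ∀ i j, |A i j| ≤ β) :
    ‖toEuclideanCLM (n := Fin N × Fin n) (𝕜 := ℝ)
      (degMat A ⊗ₖ (1 : Matrix (Fin n) (Fin n) ℝ))‖ ≤ N * β := by
  refine norm_toEuclideanCLM_le_of_sq (by positivity) fun y => ?_
  rw [Finset.mul_sum]
  refine Finset.sum_le_sum fun ic _ => ?_
  obtain ⟨i, c⟩ := ic
  rw [kronecker_one_mulVec]
  have h1 : ∑ j, degMat A i j * y (j, c) = (∑ j, A i j) * y (i, c) := by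
    simp [degMat, diagonal_apply]
  have h2 : |∑ j, A i j| ≤ N * β := by
    refine (Finset.abs_sum_le_sum_abs _ _).trans ?_
    calc ∑ j, |A i j| ≤ ∑ _j : Fin N, β := Finset.sum_le_sum fun j _ => hA i j
      _ = N * β := by simp
  rw [h1, mul_pow]
  exact mul_le_mul_of_nonneg_right
    (sq_le_sq' (neg_le_of_abs_le h2) (le_of_abs_le h2)) (sq_nonneg _)

theorem norm_delayAdj_le {A : Matrix (Fin N) (Fin N) ℝ} {lam : Fin N → Fin N → ℕ} {β : ℝ}
    (hβ : 0 ≤ β) (hA : ∀ i j, |A i j| ≤ β) (q : ℕ) :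
    ‖toEuclideanCLM (n := Fin N × Fin n) (𝕜 := ℝ) (delayAdj n A lam q)‖
      ≤ N * Real.sqrt N * β := by
  have h1 : ‖toEuclideanCLM (n := Fin N × Fin n) (𝕜 := ℝ) (delayAdj n A lam q)‖ ≤ N * β := by
    refine norm_kronecker_one_le hβ fun i j => ?_
    simp only [hadamard_apply, delayMat, of_apply]
    split_ifs
    · simpa using hA i j
    · simpa using hβ
  refine h1.trans ?_
  rcases Nat.eq_zero_or_pos N with rfl | hN
  · simp
  · have h2 : (1 : ℝ) ≤ Real.sqrt N := Real.one_le_sqrt.2 (by exact_mod_cast hN)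
    have h3 : (N : ℝ) * β * 1 ≤ N * β * Real.sqrt N := by gcongr
    linarith

theorem norm_blockHtH_le {H : ∀ i : Fin N, Matrix (Fin (ni i)) (Fin n) ℝ} {β : ℝ}
    (hH : ∀ i, specNorm (H i) ≤ β) :
    ‖toEuclideanCLM (n := Fin N × Fin n) (𝕜 := ℝ) (blockHtH H)‖ ≤ β ^ 2 := by
  refine norm_toEuclideanCLM_le_of_sq (by positivity) fun y => ?_
  rw [Fintype.sum_prod_type, Fintype.sum_prod_type, Finset.mul_sum]
  refine Finset.sum_le_sum fun i _ => ?_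
  simp only [blockHtH_mulVec]
  have hT : specNorm (H i)ᵀ ≤ β := (specNorm_transpose (H i)).trans_le (hH i)
  calc ∑ c, ((H i)ᵀ *ᵥ (H i *ᵥ fun c' => y (i, c'))) c ^ 2
      ≤ β ^ 2 * ∑ r, (H i *ᵥ fun c' => y (i, c')) r ^ 2 := sum_mulVec_sq_le hT _
    _ ≤ β ^ 2 * (β ^ 2 * ∑ c, y (i, c) ^ 2) := by
        gcongr
        exact sum_mulVec_sq_le (hH i) _
    _ = _ := by ring

/-- The stacked observation noise `ℋᵀ v`. -/
noncomputable def stackedNoise (H : ∀ i : Fin N, Matrix (Fin (ni i)) (Fin n) ℝ)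
    (v : ∀ i : Fin N, Fin (ni i) → ℝ) : EuclideanSpace ℝ (Fin N × Fin n) :=
  WithLp.toLp 2 fun ic => ((H ic.1)ᵀ *ᵥ v ic.1) ic.2

theorem norm_stackedNoise_sq_le {H : ∀ i : Fin N, Matrix (Fin (ni i)) (Fin n) ℝ}
    {v : ∀ i : Fin N, Fin (ni i) → ℝ} {β : ℝ} (hH : ∀ i, specNorm (H i) ≤ β) :
    ‖stackedNoise H v‖ ^ 2 ≤ β ^ 2 * ∑ i, ∑ p, v i p ^ 2 := by
  rw [EuclideanSpace.real_norm_sq_eq, Fintype.sum_prod_type, Finset.mul_sum]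
  refine Finset.sum_le_sum fun i _ => ?_
  simp only [stackedNoise]
  exact sum_mulVec_sq_le ((specNorm_transpose (H i)).trans_le (hH i)) (v i)

theorem delayAdj_mulVec (A : Matrix (Fin N) (Fin N) ℝ) (lam : Fin N → Fin N → ℕ) (q : ℕ)
    (y : Fin N × Fin n → ℝ) (i : Fin N) (c : Fin n) :
    (delayAdj n A lam q *ᵥ y) (i, c) = ∑ j, if lam j i = q then A i j * y (j, c) else 0 := by
  rw [delayAdj, kronecker_one_mulVec]
  refine Finset.sum_congr rfl fun j _ => ?_
  simp only [hadamard_apply, delayMat, of_apply]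
  split_ifs <;> simp

theorem sum_delayAdj {A : Matrix (Fin N) (Fin N) ℝ} {lam : Fin N → Fin N → ℕ} {d : ℕ}
    (hlam : ∀ j i, lam j i ≤ d) :
    ∑ q ∈ Finset.range (d + 1), delayAdj n A lam q = A ⊗ₖ (1 : Matrix (Fin n) (Fin n) ℝ) := by
  ext ⟨i, c⟩ ⟨j, c'⟩
  simp only [Matrix.sum_apply, delayAdj, kroneckerMap_apply, hadamard_apply, delayMat, of_apply]
  rw [← Finset.sum_mul, ← Finset.mul_sum, Finset.sum_ite_eq, if_pos, mul_one]
  exact Finset.mem_range.2 (Nat.lt_succ_of_le (hlam j i))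

/-- The stacked estimation error. -/
noncomputable def stackedError (x : Fin N → Fin n → ℝ) (x0 : Fin n → ℝ) :
    EuclideanSpace ℝ (Fin N × Fin n) :=
  WithLp.toLp 2 fun ic => x ic.1 ic.2 - x0 ic.2

/-- The algorithm in terms of the stacked estimation error. -/
theorem stackedError_succ {H : ∀ i : Fin N, Matrix (Fin (ni i)) (Fin n) ℝ}
    {v : ∀ i : Fin N, Fin (ni i) → ℝ} {A : Matrix (Fin N) (Fin N) ℝ}
    {lam : Fin N → Fin N → ℕ} {d : ℕ} (hlam : ∀ j i, lam j i ≤ d) {x0 : Fin n → ℝ} {a b : ℝ}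
    {x : ℤ → Fin N → Fin n → ℝ} {k : ℤ}
    (hrec : ∀ i p, x (k + 1) i p = x k i p
        + a * ((H i)ᵀ *ᵥ ((H i *ᵥ x0 + v i) - H i *ᵥ x k i)) p
        + b * ∑ j, A i j * (x (k - (lam j i : ℤ)) j p - x k i p)) :
    stackedError (x (k + 1)) x0 = stackedError (x k) x0
      - toEuclideanCLM (n := Fin N × Fin n) (𝕜 := ℝ)
          (b • (degMat A ⊗ₖ (1 : Matrix (Fin n) (Fin n) ℝ)) + a • blockHtH H)
          (stackedError (x k) x0)
      + b • ∑ q ∈ Finset.range (d + 1), toEuclideanCLM (n := Fin N × Fin n) (𝕜 := ℝ)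
          (delayAdj n A lam q) (stackedError (x (k - q)) x0)
      + a • stackedNoise H v := by
  ext ⟨i, p⟩
  simp only [PiLp.add_apply, PiLp.sub_apply, PiLp.smul_apply, WithLp.ofLp_sum,
    Finset.sum_apply, ofLp_toEuclideanCLM, add_mulVec, smul_mulVec, Pi.add_apply, Pi.smul_apply,
    kronecker_one_mulVec, blockHtH_mulVec, delayAdj_mulVec, smul_eq_mul]
  simp only [stackedError, stackedNoise]
  rw [hrec]
  have h1 : ∑ q ∈ Finset.range (d + 1), ∑ j,
      (if lam j i = q then A i j * (x (k - (q : ℤ)) j p - x0 p) else 0) =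
      ∑ j, A i j * (x (k - (lam j i : ℤ)) j p - x0 p) := by
    rw [Finset.sum_comm]
    refine Finset.sum_congr rfl fun j _ => ?_
    rw [Finset.sum_ite_eq, if_pos (Finset.mem_range.2 (Nat.lt_succ_of_le (hlam j i)))]
  have h2 : ∑ j, degMat A i j * (x k j p - x0 p) = ∑ j, A i j * (x k i p - x0 p) := by
    rw [← Finset.sum_mul]; simp [degMat, diagonal_apply]
  have h3 : (H i *ᵥ x0 + v i) - H i *ᵥ x k i = v i - H i *ᵥ (fun c => x k i c - x0 c) := by
    have : (fun c => x k i c - x0 c) = x k i - x0 := rfl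
    rw [this, mulVec_sub]; abel
  have h4 : ∑ j, A i j * (x (k - (lam j i : ℤ)) j p - x k i p) =
      ∑ j, A i j * (x (k - (lam j i : ℤ)) j p - x0 p) - ∑ j, A i j * (x k i p - x0 p) := by
    rw [← Finset.sum_sub_distrib]
    exact Finset.sum_congr rfl fun j _ => by ring
  rw [h1, h2, h3, h4, mulVec_sub, Pi.sub_apply]
  ring

/-- The quadratic form appearing in the excitation condition is twice that of `1 - F`. -/
theorem excitation_quadratic_form {A : Matrix (Fin N) (Fin N) ℝ} {lam : Fin N → Fin N → ℕ}
    {d : ℕ} (hlam : ∀ j i, lam j i ≤ d) {a b : ℝ} (ha : a ≠ 0)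
    (L : Matrix (Fin N × Fin n) (Fin N × Fin n) ℝ)
    (Ψ : ℕ → Matrix (Fin N × Fin n) (Fin N × Fin n) ℝ) (y : Fin N × Fin n → ℝ) :
    y ⬝ᵥ ((2 * (b / a)) • (symmLapl A ⊗ₖ (1 : Matrix (Fin n) (Fin n) ℝ)) + (2 : ℝ) • L
      - (b / a) • ∑ q ∈ Finset.range (d + 1), delayAdj n A lam q * (Ψ q - 1)
      - (b / a) • ∑ q ∈ Finset.range (d + 1), (Ψ q - 1)ᵀ * (delayAdj n A lam q)ᵀ) *ᵥ y =
    2 / a * (y ⬝ᵥ (b • (degMat A ⊗ₖ (1 : Matrix (Fin n) (Fin n) ℝ)) + a • L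
      - b • ∑ q ∈ Finset.range (d + 1), delayAdj n A lam q * Ψ q) *ᵥ y) := by
  have htr : ∀ M : Matrix (Fin N × Fin n) (Fin N × Fin n) ℝ, y ⬝ᵥ Mᵀ *ᵥ y = y ⬝ᵥ M *ᵥ y := by
    intro M
    rw [mulVec_transpose, dotProduct_comm, dotProduct_mulVec]
  have h1 : ∑ q ∈ Finset.range (d + 1), (Ψ q - 1)ᵀ * (delayAdj n A lam q)ᵀ =
      (∑ q ∈ Finset.range (d + 1), delayAdj n A lam q * (Ψ q - 1))ᵀ := by
    rw [transpose_sum]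
    simp only [transpose_mul]
  have h2 : ∑ q ∈ Finset.range (d + 1), delayAdj n A lam q * (Ψ q - 1) =
      ∑ q ∈ Finset.range (d + 1), delayAdj n A lam q * Ψ q
        - A ⊗ₖ (1 : Matrix (Fin n) (Fin n) ℝ) := by
    rw [← sum_delayAdj hlam, ← Finset.sum_sub_distrib]
    simp only [mul_sub, mul_one]
  have h3 : symmLapl A ⊗ₖ (1 : Matrix (Fin n) (Fin n) ℝ) =
      (2 : ℝ)⁻¹ • (lapl A ⊗ₖ (1 : Matrix (Fin n) (Fin n) ℝ)
        + (lapl A ⊗ₖ (1 : Matrix (Fin n) (Fin n) ℝ))ᵀ) := by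
    rw [symmLapl, smul_kronecker, add_kronecker, ← kroneckerMap_transpose, transpose_one]
  have h4 : lapl A ⊗ₖ (1 : Matrix (Fin n) (Fin n) ℝ) =
      degMat A ⊗ₖ (1 : Matrix (Fin n) (Fin n) ℝ) - A ⊗ₖ (1 : Matrix (Fin n) (Fin n) ℝ) := by
    rw [lapl, sub_eq_add_neg, add_kronecker, sub_eq_add_neg]
    congr 1
    ext ⟨i, c⟩ ⟨j, c'⟩
    simp
  rw [h1, h3]
  simp only [sub_mulVec, add_mulVec, smul_mulVec, dotProduct_sub, dotProduct_add, dotProduct_smul,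
    htr, h2, h4, smul_eq_mul]
  field_simp
  ring

theorem mul_sum_sq_le_of_le_lambdaMin {p : Type*} [Fintype p] {A : Matrix p p ℝ} {θ : ℝ}
    (hθ : 0 < θ) (hA : θ ≤ lambdaMin A) (y : p → ℝ) :
    θ * ∑ i, y i ^ 2 ≤ y ⬝ᵥ A *ᵥ y := by
  have hbdd : BddBelow (Set.range fun x : {x : p → ℝ // ∑ i, x i ^ 2 = 1} =>
      dotProduct x.1 (A.mulVec x.1)) := by
    by_contra hcon
    have : lambdaMin A = 0 := Real.iInf_of_not_bddBelow hcon
    linarith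
  by_cases hy : ∑ i, y i ^ 2 = 0
  · have h0 : y = 0 := by
      funext i
      have := (Finset.sum_eq_zero_iff_of_nonneg fun i _ => sq_nonneg (y i)).1 hy i
        (Finset.mem_univ i)
      simpa using this
    simp [h0]
  · have hs : 0 < ∑ i, y i ^ 2 :=
      lt_of_le_of_ne (Finset.sum_nonneg fun i _ => sq_nonneg (y i)) (Ne.symm hy)
    set s := ∑ i, y i ^ 2 with hsdef
    have hr : Real.sqrt s ^ 2 = s := Real.sq_sqrt hs.le
    have hr0 : 0 < Real.sqrt s := Real.sqrt_pos.2 hs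
    have hz : ∑ i, ((Real.sqrt s)⁻¹ • y) i ^ 2 = 1 := by
      simp only [Pi.smul_apply, smul_eq_mul, mul_pow]
      rw [← Finset.mul_sum, ← hsdef, inv_pow, hr, inv_mul_cancel₀ hs.ne']
    have h1 := hA.trans (ciInf_le hbdd ⟨(Real.sqrt s)⁻¹ • y, hz⟩)
    simp only [mulVec_smul, dotProduct_smul, smul_dotProduct, smul_eq_mul] at h1
    have h2 : (Real.sqrt s)⁻¹ * ((Real.sqrt s)⁻¹ * (y ⬝ᵥ A *ᵥ y)) = (y ⬝ᵥ A *ᵥ y) / s := by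
      rw [← mul_assoc, ← mul_inv, ← pow_two, hr, inv_mul_eq_div]
    rw [h2, le_div_iff₀ hs] at h1
    exact h1

end MatrixBounds

section Gains

theorem exists_le_mul_shift {a : ℕ → ℝ} (ha : ∀ k, 0 < a k) (hanti : Antitone a)
    (hO : ∀ m : ℕ, 1 ≤ m → a =O[atTop] fun k => a (k + m)) (L : ℕ) :
    ∃ M, 0 < M ∧ ∀ k j, j ≤ L → a k ≤ M * a (k + j) := by
  obtain ⟨M, hM, hle⟩ := Asymptotics.bound_of_isBigO_nat_atTop (hO (L + 1) (by omega))
  refine ⟨M, hM, fun k j hj => ?_⟩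
  have h1 := hle (ha (k + (L + 1))).ne'
  rw [Real.norm_of_nonneg (ha _).le, Real.norm_of_nonneg (ha _).le] at h1
  exact h1.trans (mul_le_mul_of_nonneg_left (hanti (by omega)) hM.le)

theorem exists_le_mul_sqrt {a b : ℕ → ℝ} (ha : ∀ k, 0 < a k)
    (hbo : (fun k => b k ^ 2) =o[atTop] a) :
    ∃ c, 0 ≤ c ∧ ∀ k, b k ≤ c * Real.sqrt (a k) := by
  obtain ⟨M, hM, hle⟩ := Asymptotics.bound_of_isBigO_nat_atTop hbo.isBigO
  refine ⟨Real.sqrt M, Real.sqrt_nonneg _, fun k => ?_⟩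
  have h1 := hle (ha k).ne'
  rw [Real.norm_of_nonneg (sq_nonneg _), Real.norm_of_nonneg (ha _).le] at h1
  rw [← Real.sqrt_mul hM.le]
  exact Real.le_sqrt_of_sq_le h1

/-- Replacing the weights `1 / a j` by `1 / a 0` in a sum over a block. -/
theorem block_sum_ge {a b s : ℕ → ℝ} {θ V C c M : ℝ} {h : ℕ} (ha : ∀ k, 0 < a k)
    (hanti : Antitone a) (hC : 0 ≤ C) (hc : 0 ≤ c) (hM : 0 < M) (hV : 0 ≤ V)
    (hb : ∀ k, b k ≤ c * Real.sqrt (a k)) (haM : ∀ j < h, a 0 ≤ M * a j)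
    (hs : ∀ j < h, |s j| ≤ C * b j * V)
    (hsum : θ * V ≤ ∑ j ∈ Finset.range h, s j / a j) :
    a 0 * θ * V - C * c * (Real.sqrt M + 1) * h * (Real.sqrt (a 0) - Real.sqrt (a h)) * V ≤
      ∑ j ∈ Finset.range h, s j := by
  have hterm : ∀ j ∈ Finset.range h, a 0 * (s j / a j) - s j ≤
      C * c * (Real.sqrt M + 1) * (Real.sqrt (a 0) - Real.sqrt (a h)) * V := by
    intro j hj
    have hj := Finset.mem_range.1 hj
    have haj := ha j
    have hr : 0 < Real.sqrt (a j) := Real.sqrt_pos.2 haj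
    have e0 : Real.sqrt (a 0) ^ 2 = a 0 := Real.sq_sqrt (ha 0).le
    have ej : Real.sqrt (a j) ^ 2 = a j := Real.sq_sqrt haj.le
    have h0j : Real.sqrt (a j) ≤ Real.sqrt (a 0) := Real.sqrt_le_sqrt (hanti (Nat.zero_le j))
    have hjh : Real.sqrt (a h) ≤ Real.sqrt (a j) := Real.sqrt_le_sqrt (hanti hj.le)
    have hMj : Real.sqrt (a 0) ≤ Real.sqrt M * Real.sqrt (a j) := by
      rw [← Real.sqrt_mul hM.le]; exact Real.sqrt_le_sqrt (haM j hj)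
    have h1 : a 0 * (s j / a j) - s j = (a 0 - a j) / a j * s j := by field_simp
    have h2 : 0 ≤ (a 0 - a j) / a j :=
      div_nonneg (sub_nonneg.2 (hanti (Nat.zero_le j))) haj.le
    have h3 : s j ≤ C * (c * Real.sqrt (a j)) * V :=
      (le_abs_self _).trans ((hs j hj).trans (by gcongr; exact hb j))
    have h4 : (a 0 - a j) / a j * Real.sqrt (a j) ≤
        (Real.sqrt M + 1) * (Real.sqrt (a 0) - Real.sqrt (a h)) := by
      have h5 : (a 0 - a j) / a j * Real.sqrt (a j) =
          (Real.sqrt (a 0) + Real.sqrt (a j)) / Real.sqrt (a j)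
            * (Real.sqrt (a 0) - Real.sqrt (a j)) := by
        rw [← e0]
        nth_rewrite 1 [← ej]
        nth_rewrite 2 [← ej]
        rw [Real.sqrt_sq (Real.sqrt_nonneg _)]
        field_simp
        ring
      rw [h5]
      refine mul_le_mul ?_ (by linarith) (by linarith) (by positivity)
      rw [div_le_iff₀ hr]
      linarith
    calc a 0 * (s j / a j) - s j ≤ (a 0 - a j) / a j * (C * (c * Real.sqrt (a j)) * V) := by
          rw [h1]; exact mul_le_mul_of_nonneg_left h3 h2
      _ = C * c * V * ((a 0 - a j) / a j * Real.sqrt (a j)) := by ring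
      _ ≤ C * c * V * ((Real.sqrt M + 1) * (Real.sqrt (a 0) - Real.sqrt (a h))) := by gcongr
      _ = _ := by ring
  have h6 := Finset.sum_le_sum hterm
  rw [Finset.sum_sub_distrib, ← Finset.mul_sum, Finset.sum_const, Finset.card_range,
    nsmul_eq_mul] at h6
  have h7 : a 0 * (θ * V) ≤ a 0 * ∑ j ∈ Finset.range h, s j / a j :=
    mul_le_mul_of_nonneg_left hsum (ha 0).le
  linarith

theorem tendsto_sum_block_start {a : ℕ → ℝ} (hanti : Antitone a)
    (hdiv : Tendsto (fun K => ∑ k ∈ Finset.range K, a k) atTop atTop) {h : ℕ} (hh : 1 ≤ h) :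
    Tendsto (fun K => ∑ m ∈ Finset.range K, a (m * h)) atTop atTop := by
  have h1 : ∀ K, ∑ k ∈ Finset.range (K * h), a k ≤ h * ∑ m ∈ Finset.range K, a (m * h) := by
    intro K
    induction K with
    | zero => simp
    | succ K ih =>
      rw [Nat.succ_mul, Finset.sum_range_add, Finset.sum_range_succ, mul_add]
      refine add_le_add ih ?_
      calc ∑ j ∈ Finset.range h, a (K * h + j) ≤ ∑ _j ∈ Finset.range h, a (K * h) :=
            Finset.sum_le_sum fun j _ => hanti (by omega)
        _ = h * a (K * h) := by simp
  have hh0 : (0 : ℝ) < h := by exact_mod_cast hh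
  have h2 : Tendsto (fun K => ∑ k ∈ Finset.range (K * h), a k) atTop atTop :=
    hdiv.comp (tendsto_id.atTop_mul_const' hh)
  have h3 := tendsto_atTop_mono h1 h2
  exact (tendsto_const_mul_atTop_of_pos hh0).1 h3

end Gains

section MeanSquare

variable {Ω : Type*} [MeasurableSpace Ω] {μ : Measure Ω}
  {E : Type*} [NormedAddCommGroup E]

theorem integrable_norm_sq {f : Ω → E} (hf : MemLp f 2 μ) : Integrable (fun ω => ‖f ω‖ ^ 2) μ :=
  hf.norm.integrable_sq

theorem sum_norm_window_le (g : ℕ → E) {d h k₀ j : ℕ} (hk : d ≤ k₀) (hj : j < h) :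
    ∑ i ∈ Finset.range d, ‖g (k₀ + j - (i + 1))‖ ≤
      ∑ s ∈ Finset.Ico (k₀ - d) (k₀ + h), ‖g s‖ := by
  rw [← Finset.sum_image (f := fun s => ‖g s‖) (g := fun i => k₀ + j - (i + 1))]
  · refine Finset.sum_le_sum_of_subset_of_nonneg (fun s hs => ?_) fun _ _ _ => norm_nonneg _
    obtain ⟨i, hi, rfl⟩ := Finset.mem_image.1 hs
    have := Finset.mem_range.1 hi
    exact Finset.mem_Ico.2 ⟨by omega, by omega⟩
  · intro i hi i' hi' hii
    have := Finset.mem_range.1 hi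
    have := Finset.mem_range.1 hi'
    simp only at hii
    omega

/-- The second moments of the defect are of the order of the squared innovation gain. -/
theorem exists_integral_defect_sq_le {g w : ℕ → Ω → E} {a b : ℕ → ℝ} {C C₁ M : ℝ} {d : ℕ}
    (hg : ∀ k, MemLp (g k) 2 μ) (hw : ∀ k, MemLp (w k) 2 μ) (ha : ∀ k, 0 < a k)
    (hC₁ : 0 ≤ C₁) (haM : ∀ k j, j ≤ d → a k ≤ M * a (k + j)) (hb : Tendsto b atTop (𝓝 0))
    (hgw : ∀ᵐ ω ∂μ, ∀ k, d ≤ k →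
      ‖g k ω - w k ω‖ ≤ C * b k * ∑ j ∈ Finset.range d, ‖g (k - (j + 1)) ω‖)
    (hw2 : ∀ k, ∫ ω, ‖w k ω‖ ^ 2 ∂μ ≤ C₁ * a k ^ 2) :
    ∃ R, 0 ≤ R ∧ ∀ k, ∫ ω, ‖g k ω‖ ^ 2 ∂μ ≤ R * a k ^ 2 := by
  refine exists_le_mul_sq_of_delayed_recursion (C₁ := 2 * C₁) (C₂ := 2 * C ^ 2 * d) ha
    (fun k => integral_nonneg fun ω => sq_nonneg _) (by positivity) haM hb fun k hk => ?_
  have hpt : ∀ᵐ ω ∂μ, ‖g k ω‖ ^ 2 ≤ 2 * ‖w k ω‖ ^ 2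
      + 2 * C ^ 2 * d * b k ^ 2 * ∑ j ∈ Finset.range d, ‖g (k - (j + 1)) ω‖ ^ 2 := by
    filter_upwards [hgw] with ω hω
    set S := ∑ j ∈ Finset.range d, ‖g (k - (j + 1)) ω‖ with hS
    have h1 : ‖g k ω‖ ≤ ‖w k ω‖ + C * b k * S := by
      have := norm_sub_norm_le (g k ω) (w k ω)
      linarith [hω k hk]
    have h2 : S ^ 2 ≤ d * ∑ j ∈ Finset.range d, ‖g (k - (j + 1)) ω‖ ^ 2 := by
      simpa using sq_sum_le_card_mul_sum_sq (s := Finset.range d)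
        (f := fun j => ‖g (k - (j + 1)) ω‖)
    have h3 := pow_le_pow_left₀ (norm_nonneg _) h1 2
    have h4 : (C * b k) ^ 2 * S ^ 2 ≤ (C * b k) ^ 2 *
        (d * ∑ j ∈ Finset.range d, ‖g (k - (j + 1)) ω‖ ^ 2) := by gcongr
    nlinarith [sq_nonneg (‖w k ω‖ - C * b k * S)]
  have hi1 : Integrable (fun ω => 2 * ‖w k ω‖ ^ 2) μ := (integrable_norm_sq (hw k)).const_mul 2
  have hi2 : Integrable (fun ω => ∑ j ∈ Finset.range d, ‖g (k - (j + 1)) ω‖ ^ 2) μ :=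
    integrable_finsetSum _ fun j _ => integrable_norm_sq (hg _)
  calc ∫ ω, ‖g k ω‖ ^ 2 ∂μ ≤ ∫ ω, (2 * ‖w k ω‖ ^ 2
      + 2 * C ^ 2 * d * b k ^ 2 * ∑ j ∈ Finset.range d, ‖g (k - (j + 1)) ω‖ ^ 2) ∂μ :=
        integral_mono_ae (integrable_norm_sq (hg k)) (hi1.add (hi2.const_mul _)) hpt
    _ = 2 * ∫ ω, ‖w k ω‖ ^ 2 ∂μ
      + 2 * C ^ 2 * d * b k ^ 2 * ∑ j ∈ Finset.range d, ∫ ω, ‖g (k - (j + 1)) ω‖ ^ 2 ∂μ := by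
        rw [integral_add hi1 (hi2.const_mul _), integral_const_mul, integral_const_mul,
          integral_finsetSum _ fun j _ => integrable_norm_sq (hg _)]
    _ ≤ _ := by nlinarith [hw2 k]

theorem integral_window_sq_le {g : ℕ → Ω → E} {a : ℕ → ℝ} {R M : ℝ} {d h k₀ : ℕ}
    (hg : ∀ k, MemLp (g k) 2 μ) (ha : ∀ k, 0 < a k) (hanti : Antitone a) (hR : 0 ≤ R)
    (haM : ∀ k j, j ≤ d → a k ≤ M * a (k + j))
    (hgR : ∀ k, ∫ ω, ‖g k ω‖ ^ 2 ∂μ ≤ R * a k ^ 2) (hk : d ≤ k₀) :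
    Integrable (fun ω => (∑ s ∈ Finset.Ico (k₀ - d) (k₀ + h), ‖g s ω‖) ^ 2) μ ∧
    ∫ ω, (∑ s ∈ Finset.Ico (k₀ - d) (k₀ + h), ‖g s ω‖) ^ 2 ∂μ ≤
      (h + d) ^ 2 * R * M ^ 2 * a k₀ ^ 2 := by
  have hInt : Integrable (fun ω => (∑ s ∈ Finset.Ico (k₀ - d) (k₀ + h), ‖g s ω‖) ^ 2) μ :=
    (memLp_finsetSum _ fun s _ => (hg s).norm).integrable_sq
  have hcard : ((Finset.Ico (k₀ - d) (k₀ + h)).card : ℝ) = h + d := by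
    rw [Nat.card_Ico, show k₀ + h - (k₀ - d) = h + d by omega]; push_cast; ring
  refine ⟨hInt, ?_⟩
  calc ∫ ω, (∑ s ∈ Finset.Ico (k₀ - d) (k₀ + h), ‖g s ω‖) ^ 2 ∂μ
      ≤ ∫ ω, (h + d) * ∑ s ∈ Finset.Ico (k₀ - d) (k₀ + h), ‖g s ω‖ ^ 2 ∂μ := by
        refine integral_mono hInt ((integrable_finsetSum _ fun s _ =>
          integrable_norm_sq (hg s)).const_mul _) fun ω => ?_
        simp only
        rw [← hcard]
        exact sq_sum_le_card_mul_sum_sq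
    _ = (h + d) * ∑ s ∈ Finset.Ico (k₀ - d) (k₀ + h), ∫ ω, ‖g s ω‖ ^ 2 ∂μ := by
        rw [integral_const_mul, integral_finsetSum _ fun s _ => integrable_norm_sq (hg s)]
    _ ≤ (h + d) * ∑ _s ∈ Finset.Ico (k₀ - d) (k₀ + h), R * (M * a k₀) ^ 2 := by
        gcongr with s hs
        refine (hgR s).trans ?_
        have h1 : a s ≤ M * a k₀ := by
          have h2 := haM (k₀ - d) d le_rfl
          rw [Nat.sub_add_cancel hk] at h2
          exact (hanti (Finset.mem_Ico.1 hs).1).trans h2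
        have := (ha s).le
        gcongr
    _ = _ := by
        rw [Finset.sum_const, nsmul_eq_mul, hcard]; ring

end MeanSquare

section Core

variable {Ω : Type*} [MeasurableSpace Ω] {μ : Measure Ω}
  {E : Type*} [NormedAddCommGroup E] [InnerProductSpace ℝ E]

theorem integrable_inner_of_memLp {f g : Ω → E} (hf : MemLp f 2 μ) (hg : MemLp g 2 μ) :
    Integrable (fun ω => inner ℝ (f ω) (g ω)) μ := by
  refine ((integrable_norm_sq hf).add (integrable_norm_sq hg)).mono'
    (hf.aestronglyMeasurable.inner hg.aestronglyMeasurable) (ae_of_all _ fun ω => ?_)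
  have h1 := norm_inner_le_norm (𝕜 := ℝ) (f ω) (g ω)
  simp only [Pi.add_apply]
  nlinarith [sq_nonneg (‖f ω‖ - ‖g ω‖), norm_nonneg (f ω), norm_nonneg (g ω)]

/-- One-block mean square estimate. -/
theorem integral_norm_sq_block_le {e g w : ℕ → Ω → E} {G : ℕ → Ω → E →L[ℝ] E}
    {a b : ℕ → ℝ} {C R M : ℝ} {d h k₀ : ℕ}
    (he : ∀ k, MemLp (e k) 2 μ) (hg : ∀ k, MemLp (g k) 2 μ) (hw : ∀ k, MemLp (w k) 2 μ)
    (hGint : ∀ l k, Integrable (fun ω => inner ℝ (e l ω) (G k ω (e l ω))) μ)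
    (ha : ∀ k, 0 < a k) (hanti : Antitone a) (hb : ∀ k, 0 < b k) (hbanti : Antitone b)
    (hC : 0 ≤ C) (hR : 0 ≤ R) (haM : ∀ k j, j ≤ d → a k ≤ M * a (k + j))
    (hG : ∀ᵐ ω ∂μ, ∀ k, ‖G k ω‖ ≤ C * b k)
    (hrec : ∀ᵐ ω ∂μ, ∀ k, e (k + 1) ω = e k ω - G k ω (e k ω) + g k ω)
    (hgw : ∀ᵐ ω ∂μ, ∀ k, d ≤ k →
      ‖g k ω - w k ω‖ ≤ C * b k * ∑ j ∈ Finset.range d, ‖g (k - (j + 1)) ω‖)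
    (hgR : ∀ k, ∫ ω, ‖g k ω‖ ^ 2 ∂μ ≤ R * a k ^ 2)
    (horth : ∀ l k, l ≤ k → ∫ ω, inner ℝ (e l ω) (w k ω) ∂μ = 0) (hk : d ≤ k₀) :
    ∫ ω, ‖e (k₀ + h) ω‖ ^ 2 ∂μ ≤ ∫ ω, ‖e k₀ ω‖ ^ 2 ∂μ
      - ∑ j ∈ Finset.range h, 2 * ∫ ω, inner ℝ (e k₀ ω) (G (k₀ + j) ω (e k₀ ω)) ∂μ
      + 2 * (2 * h + 2 * h * (2 + C * b 0) ^ h + ((2 + C * b 0) ^ h) ^ 2) *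
        (C ^ 2 * b k₀ ^ 2 * ∫ ω, ‖e k₀ ω‖ ^ 2 ∂μ + (h + d) ^ 2 * R * M ^ 2 * a k₀ ^ 2) := by
  obtain ⟨hΓi, hΓ⟩ := integral_window_sq_le (h := h) hg ha hanti hR haM hgR hk
  set Γ : Ω → ℝ := fun ω => ∑ s ∈ Finset.Ico (k₀ - d) (k₀ + h), ‖g s ω‖ with hΓdef
  set K := 2 * (2 * h + 2 * h * (2 + C * b 0) ^ h + ((2 + C * b 0) ^ h) ^ 2) with hK
  have hK0 : 0 ≤ K := by have := (hb 0).le; positivity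
  have hpt : ∀ᵐ ω ∂μ, ‖e (k₀ + h) ω‖ ^ 2 ≤ ‖e k₀ ω‖ ^ 2
      - 2 * ∑ j ∈ Finset.range h, inner ℝ (e k₀ ω) (G (k₀ + j) ω (e k₀ ω))
      + 2 * ∑ j ∈ Finset.range h, inner ℝ (e k₀ ω) (w (k₀ + j) ω)
      + K * (C ^ 2 * b k₀ ^ 2 * ‖e k₀ ω‖ ^ 2 + Γ ω ^ 2) := by
    filter_upwards [hG, hrec, hgw] with ω hGω hrω hgω
    have hΓ0 : 0 ≤ Γ ω := Finset.sum_nonneg fun _ _ => norm_nonneg _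
    have hb' : ∀ j, C * b (k₀ + j) ≤ C * b k₀ := fun j =>
      mul_le_mul_of_nonneg_left (hbanti (by omega)) hC
    have := norm_sq_block_le (e := fun j => e (k₀ + j) ω) (g := fun j => g (k₀ + j) ω)
      (w := fun j => w (k₀ + j) ω) (G := fun j => G (k₀ + j) ω) (β := C * b k₀)
      (B := C * b 0) (Γ := Γ ω) (h := h) (mul_nonneg hC (hb _).le)
      (mul_le_mul_of_nonneg_left (hbanti (Nat.zero_le _)) hC) hΓ0
      (fun j _ => (hGω _).trans (hb' j))
      (fun j hj => Finset.single_le_sum (f := fun s => ‖g s ω‖) (fun _ _ => norm_nonneg _)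
        (Finset.mem_Ico.2 ⟨by omega, by omega⟩))
      (fun j hj => (hgω _ (by omega)).trans (mul_le_mul (hb' j)
        (sum_norm_window_le (fun s => g s ω) hk hj)
        (Finset.sum_nonneg fun _ _ => norm_nonneg _) (mul_nonneg hC (hb _).le)))
      (fun j _ => hrω (k₀ + j))
    simp only [add_zero, mul_pow] at this
    exact this
  have hi1 := integrable_norm_sq (he k₀)
  have hi2 : Integrable (fun ω => 2 * ∑ j ∈ Finset.range h,
      inner ℝ (e k₀ ω) (G (k₀ + j) ω (e k₀ ω))) μ :=
    (integrable_finsetSum _ fun j _ => hGint k₀ (k₀ + j)).const_mul 2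
  have hi3' : ∀ j, Integrable (fun ω => inner ℝ (e k₀ ω) (w (k₀ + j) ω)) μ := fun j =>
    integrable_inner_of_memLp (he k₀) (hw (k₀ + j))
  have hi3 : Integrable (fun ω => 2 * ∑ j ∈ Finset.range h,
      inner ℝ (e k₀ ω) (w (k₀ + j) ω)) μ :=
    (integrable_finsetSum _ fun j _ => hi3' j).const_mul 2
  have hi4 : Integrable (fun ω => C ^ 2 * b k₀ ^ 2 * ‖e k₀ ω‖ ^ 2 + Γ ω ^ 2) μ :=
    (hi1.const_mul _).add hΓi
  have hmono := integral_mono_ae (integrable_norm_sq (he (k₀ + h)))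
    (((hi1.sub hi2).add hi3).add (hi4.const_mul K)) hpt
  refine hmono.trans ?_
  rw [integral_add' ((hi1.sub hi2).add hi3) (hi4.const_mul K), integral_add' (hi1.sub hi2) hi3,
    integral_sub' hi1 hi2, integral_const_mul, integral_const_mul, integral_const_mul,
    integral_add (hi1.const_mul _) hΓi, integral_const_mul,
    integral_finsetSum _ fun j _ => hGint k₀ (k₀ + j), integral_finsetSum _ fun j _ => hi3' j,
    Finset.sum_eq_zero fun j _ => horth k₀ (k₀ + j) (by omega), ← Finset.mul_sum]
  have : K * (C ^ 2 * b k₀ ^ 2 * ∫ ω, ‖e k₀ ω‖ ^ 2 ∂μ + ∫ ω, Γ ω ^ 2 ∂μ) ≤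
      K * (C ^ 2 * b k₀ ^ 2 * ∫ ω, ‖e k₀ ω‖ ^ 2 ∂μ + (h + d) ^ 2 * R * M ^ 2 * a k₀ ^ 2) := by
    gcongr
  linarith

theorem integral_norm_sq_in_block_le {e g : ℕ → Ω → E} {G : ℕ → Ω → E →L[ℝ] E}
    {a b : ℕ → ℝ} {C R M : ℝ} {d h k₀ : ℕ}
    (he : ∀ k, MemLp (e k) 2 μ) (hg : ∀ k, MemLp (g k) 2 μ)
    (ha : ∀ k, 0 < a k) (hanti : Antitone a) (hb : ∀ k, 0 < b k) (hbanti : Antitone b)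
    (hC : 0 ≤ C) (hR : 0 ≤ R) (haM : ∀ k j, j ≤ d → a k ≤ M * a (k + j))
    (hG : ∀ᵐ ω ∂μ, ∀ k, ‖G k ω‖ ≤ C * b k)
    (hrec : ∀ᵐ ω ∂μ, ∀ k, e (k + 1) ω = e k ω - G k ω (e k ω) + g k ω)
    (hgR : ∀ k, ∫ ω, ‖g k ω‖ ^ 2 ∂μ ≤ R * a k ^ 2) (hk : d ≤ k₀) {j : ℕ} (hj : j < h) :
    ∫ ω, ‖e (k₀ + j) ω‖ ^ 2 ∂μ ≤
      2 * (1 + (2 + C * b 0) ^ h * (1 + C * b 0)) ^ 2 *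
        (∫ ω, ‖e k₀ ω‖ ^ 2 ∂μ + (h + d) ^ 2 * R * M ^ 2 * a k₀ ^ 2) := by
  obtain ⟨hΓi, hΓ⟩ := integral_window_sq_le (h := h) hg ha hanti hR haM hgR hk
  set Γ : Ω → ℝ := fun ω => ∑ s ∈ Finset.Ico (k₀ - d) (k₀ + h), ‖g s ω‖ with hΓdef
  have hB : 0 ≤ C * b 0 := mul_nonneg hC (hb 0).le
  set B := C * b 0 with hBdef
  set K := 1 + (2 + B) ^ h * (1 + B) with hK
  have hK0 : 0 ≤ K := by positivity
  have hi := integrable_norm_sq (he k₀)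
  have hpt : ∀ᵐ ω ∂μ, ‖e (k₀ + j) ω‖ ^ 2 ≤ 2 * K ^ 2 * (‖e k₀ ω‖ ^ 2 + Γ ω ^ 2) := by
    filter_upwards [hG, hrec] with ω hGω hrω
    have hΓ0 : 0 ≤ Γ ω := Finset.sum_nonneg fun _ _ => norm_nonneg _
    have h1 := norm_sub_initial_le (e := fun j => e (k₀ + j) ω) (g := fun j => g (k₀ + j) ω)
      (G := fun j => G (k₀ + j) ω) (β := B) (B := B) (Γ := Γ ω) (h := h) hB le_rfl hΓ0
      (fun j _ => (hGω _).trans (mul_le_mul_of_nonneg_left (hbanti (Nat.zero_le _)) hC))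
      (fun j hj => Finset.single_le_sum (f := fun s => ‖g s ω‖) (fun _ _ => norm_nonneg _)
        (Finset.mem_Ico.2 ⟨by omega, by omega⟩))
      (fun j _ => hrω (k₀ + j)) j hj.le
    simp only [add_zero] at h1
    have h2 : (2 + B) ^ j ≤ (2 + B) ^ h := pow_le_pow_right₀ (by linarith) hj.le
    have h3 := norm_sub_norm_le (e (k₀ + j) ω) (e k₀ ω)
    have h4 : ‖e (k₀ + j) ω‖ ≤ K * (‖e k₀ ω‖ + Γ ω) := by
      have hn := norm_nonneg (e k₀ ω)
      have h5 : (2 + B) ^ j * (B * ‖e k₀ ω‖ + Γ ω) ≤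
          (2 + B) ^ h * ((1 + B) * (‖e k₀ ω‖ + Γ ω)) := by
        refine mul_le_mul h2 ?_ (by positivity) (by positivity)
        nlinarith [mul_nonneg hB hΓ0]
      rw [hK]
      nlinarith
    have h6 := pow_le_pow_left₀ (norm_nonneg _) h4 2
    rw [mul_pow] at h6
    refine h6.trans ?_
    rw [mul_comm (2 : ℝ), mul_assoc]
    gcongr
    nlinarith [sq_nonneg (‖e k₀ ω‖ - Γ ω)]
  refine (integral_mono_ae (integrable_norm_sq (he _)) ((hi.add hΓi).const_mul _) hpt).trans ?_
  simp only [Pi.add_apply]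
  rw [integral_const_mul, integral_add hi hΓi]
  gcongr

/-- Mean square convergence of a perturbed linear random recursion under blockwise excitation. -/
theorem tendsto_integral_norm_sq_zero
    {e g w : ℕ → Ω → E} {G : ℕ → Ω → E →L[ℝ] E}
    {a b : ℕ → ℝ} {C C₁ θ : ℝ} {d h : ℕ}
    (he : ∀ k, MemLp (e k) 2 μ) (hg : ∀ k, MemLp (g k) 2 μ) (hw : ∀ k, MemLp (w k) 2 μ)
    (hGint : ∀ l k, Integrable (fun ω => inner ℝ (e l ω) (G k ω (e l ω))) μ)
    (ha : ∀ k, 0 < a k) (hb : ∀ k, 0 < b k) (hanti : Antitone a) (hbanti : Antitone b)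
    (halim : Tendsto a atTop (𝓝 0)) (hblim : Tendsto b atTop (𝓝 0))
    (hO : ∀ m : ℕ, 1 ≤ m → a =O[atTop] fun k => a (k + m))
    (hbo : (fun k => b k ^ 2) =o[atTop] a)
    (hdiv : Tendsto (fun K => ∑ k ∈ Finset.range K, a k) atTop atTop)
    (hC : 0 ≤ C) (hC₁ : 0 ≤ C₁) (hh : 1 ≤ h) (hθ : 0 < θ)
    (hG : ∀ᵐ ω ∂μ, ∀ k, ‖G k ω‖ ≤ C * b k)
    (hrec : ∀ᵐ ω ∂μ, ∀ k, e (k + 1) ω = e k ω - G k ω (e k ω) + g k ω)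
    (hgw : ∀ᵐ ω ∂μ, ∀ k, d ≤ k →
      ‖g k ω - w k ω‖ ≤ C * b k * ∑ j ∈ Finset.range d, ‖g (k - (j + 1)) ω‖)
    (hw2 : ∀ k, ∫ ω, ‖w k ω‖ ^ 2 ∂μ ≤ C₁ * a k ^ 2)
    (horth : ∀ l k, l ≤ k → ∫ ω, inner ℝ (e l ω) (w k ω) ∂μ = 0)
    (hexc : ∀ m, θ * ∫ ω, ‖e (m * h) ω‖ ^ 2 ∂μ ≤ ∑ j ∈ Finset.range h,
      2 * (∫ ω, inner ℝ (e (m * h) ω) (G (m * h + j) ω (e (m * h) ω)) ∂μ) / a (m * h + j)) :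
    Tendsto (fun k => ∫ ω, ‖e k ω‖ ^ 2 ∂μ) atTop (𝓝 0) := by
  obtain ⟨M, hM, haM'⟩ := exists_le_mul_shift ha hanti hO (d + h)
  have haM : ∀ k j, j ≤ d → a k ≤ M * a (k + j) := fun k j hj => haM' k j (by omega)
  obtain ⟨c, hc, hbc⟩ := exists_le_mul_sqrt ha hbo
  obtain ⟨R, hR, hgR⟩ := exists_integral_defect_sq_le hg hw ha hC₁ haM hblim hgw hw2
  set V : ℕ → ℝ := fun m => ∫ ω, ‖e (m * h) ω‖ ^ 2 ∂μ with hV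
  have hV0 : ∀ m, 0 ≤ V m := fun m => integral_nonneg fun ω => sq_nonneg _
  set K := 2 * (2 * h + 2 * h * (2 + C * b 0) ^ h + ((2 + C * b 0) ^ h) ^ 2) with hK
  have hK0 : 0 ≤ K := by have := (hb 0).le; positivity
  set D := (h + d) ^ 2 * R * M ^ 2 with hD
  have hmul : Tendsto (fun m : ℕ => m * h) atTop atTop := tendsto_id.atTop_mul_const' hh
  have hVlim : Tendsto V atTop (𝓝 0) := by
    set c' := 2 * C * c * (Real.sqrt M + 1) * h with hc'
    have hc'0 : 0 ≤ c' := by positivity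
    refine tendsto_zero_of_perturbed_contraction (α := fun m => θ / 2 * a (m * h))
      (u := fun m => c' * Real.sqrt (a (m * h))) (ε := fun m => 2 / θ * (K * D) * a (m * h))
      hV0 ?_ ?_ ?_ ?_ ?_ ?_
    · have h1 : Tendsto (fun m => θ / 2 * a (m * h)) atTop (𝓝 0) := by
        simpa using (halim.comp hmul).const_mul (θ / 2)
      filter_upwards [h1.eventually (Iic_mem_nhds (show (0 : ℝ) < 1 / 2 by norm_num))] with m hm
      exact ⟨by have := (ha (m * h)).le; positivity, hm⟩
    · simp_rw [← Finset.mul_sum]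
      exact (tendsto_sum_block_start hanti hdiv hh).const_mul_atTop (by positivity)
    · intro m m' hmm
      exact mul_le_mul_of_nonneg_left
        (Real.sqrt_le_sqrt (hanti (Nat.mul_le_mul_right h hmm))) hc'0
    · intro m; positivity
    · simpa using (halim.comp hmul).const_mul (2 / θ * (K * D))
    · have hsmall : ∀ᶠ k in atTop, K * C ^ 2 * b k ^ 2 ≤ θ / 2 * a k := by
        have h1 := (hbo.const_mul_left (K * C ^ 2)).bound (show (0 : ℝ) < θ / 2 by positivity)
        filter_upwards [h1] with k hk
        rw [Real.norm_of_nonneg (by positivity), Real.norm_of_nonneg (ha k).le] at hk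
        exact hk
      filter_upwards [hmul.eventually hsmall, eventually_ge_atTop d] with m hm hmd
      have hkd : d ≤ m * h := hmd.trans (Nat.le_mul_of_pos_right m hh)
      have h1 := integral_norm_sq_block_le (h := h) he hg hw hGint ha hanti hb hbanti hC hR haM
        hG hrec hgw hgR horth hkd
      rw [← hK, ← hD] at h1
      have h2 := block_sum_ge (a := fun j => a (m * h + j)) (b := fun j => b (m * h + j))
        (s := fun j => 2 * ∫ ω, inner ℝ (e (m * h) ω) (G (m * h + j) ω (e (m * h) ω)) ∂μ)
        (θ := θ) (V := V m) (C := 2 * C) (c := c) (M := M) (h := h) (fun j => ha _)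
        (fun i j hij => hanti (by omega)) (by positivity) hc hM (hV0 m) (fun j => hbc _)
        (fun j hj => haM' _ _ (by omega)) ?_ (hexc m)
      · have e1 : V (m + 1) = ∫ ω, ‖e (m * h + h) ω‖ ^ 2 ∂μ := by
          simp only [hV, Nat.succ_mul]
        have e2 : ∫ ω, ‖e (m * h) ω‖ ^ 2 ∂μ = V m := rfl
        rw [e2, ← e1] at h1
        simp only [add_zero, ← hc'] at h2
        have e3 : (m + 1) * h = m * h + h := by ring
        rw [e3]
        have h3 : K * C ^ 2 * b (m * h) ^ 2 * V m ≤ θ / 2 * a (m * h) * V m :=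
          mul_le_mul_of_nonneg_right hm (hV0 m)
        have h4 : θ / 2 * a (m * h) * (2 / θ * (K * D) * a (m * h)) =
            K * (D * a (m * h) ^ 2) := by field_simp
        rw [h4]
        linarith
      · intro j _
        have h3 : |∫ ω, inner ℝ (e (m * h) ω) (G (m * h + j) ω (e (m * h) ω)) ∂μ| ≤
            C * b (m * h + j) * V m := by
          rw [← Real.norm_eq_abs, ← integral_const_mul]
          refine norm_integral_le_of_norm_le ((integrable_norm_sq (he _)).const_mul _) ?_
          filter_upwards [hG] with ω hω
          calc ‖inner ℝ (e (m * h) ω) (G (m * h + j) ω (e (m * h) ω))‖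
              ≤ ‖e (m * h) ω‖ * ‖G (m * h + j) ω (e (m * h) ω)‖ := norm_inner_le_norm _ _
            _ ≤ ‖e (m * h) ω‖ * (C * b (m * h + j) * ‖e (m * h) ω‖) := by
                gcongr
                exact ContinuousLinearMap.le_of_opNorm_le _ (hω _) _
            _ = _ := by ring
        rw [abs_mul, abs_two]
        linarith
  have hdivh : Tendsto (fun k : ℕ => k / h) atTop atTop := Nat.tendsto_div_const_atTop (by omega)
  have hbound : Tendsto (fun k => 2 * (1 + (2 + C * b 0) ^ h * (1 + C * b 0)) ^ 2 *
      (V (k / h) + D * a (k / h * h) ^ 2)) atTop (𝓝 0) := by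
    have h1 := (hVlim.add (((halim.comp hmul).pow 2).const_mul D)).comp hdivh
    simpa using h1.const_mul (2 * (1 + (2 + C * b 0) ^ h * (1 + C * b 0)) ^ 2)
  refine squeeze_zero' (Eventually.of_forall fun k => integral_nonneg fun ω => sq_nonneg _) ?_
    hbound
  filter_upwards [hdivh.eventually (eventually_ge_atTop d)] with k hk
  have h1 := integral_norm_sq_in_block_le (h := h) (k₀ := k / h * h) (j := k % h) he hg ha hanti
    hb hbanti hC hR haM hG hrec hgR (hk.trans (Nat.le_mul_of_pos_right _ hh))
    (Nat.mod_lt _ (by omega))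
  rwa [Nat.div_add_mod'] at h1

end Core

section Orthogonality

variable {Ω : Type*} {m0 : MeasurableSpace Ω} {μ : Measure Ω}

theorem generateFrom_image2_inter (m₁ m₂ : MeasurableSpace Ω) :
    MeasurableSpace.generateFrom
      (Set.image2 (· ∩ ·) {s | MeasurableSet[m₁] s} {s | MeasurableSet[m₂] s}) = m₁ ⊔ m₂ := by
  refine le_antisymm (MeasurableSpace.generateFrom_le ?_) (sup_le ?_ ?_)
  · rintro _ ⟨s, hs, t, ht, rfl⟩
    exact MeasurableSet.inter (m := m₁ ⊔ m₂) ((le_sup_left : m₁ ≤ m₁ ⊔ m₂) s hs)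
      ((le_sup_right : m₂ ≤ m₁ ⊔ m₂) t ht)
  · intro s hs
    exact MeasurableSpace.measurableSet_generateFrom
      ⟨s, hs, Set.univ, MeasurableSet.univ (m := m₂), by simp⟩
  · intro s hs
    exact MeasurableSpace.measurableSet_generateFrom
      ⟨Set.univ, MeasurableSet.univ (m := m₁), s, hs, by simp⟩

theorem isPiSystem_image2_inter (m₁ m₂ : MeasurableSpace Ω) :
    IsPiSystem (Set.image2 (· ∩ ·) {s | MeasurableSet[m₁] s} {s | MeasurableSet[m₂] s}) := by
  rintro _ ⟨s, hs, t, ht, rfl⟩ _ ⟨s', hs', t', ht', rfl⟩ _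
  exact ⟨s ∩ s', MeasurableSet.inter (m := m₁) hs hs', t ∩ t',
    MeasurableSet.inter (m := m₂) ht ht', Set.inter_inter_inter_comm s s' t t'⟩

/-- Enlarging the conditioning σ-field by independent information preserves a zero conditional
mean. -/
theorem condExp_sup_eq_zero [IsProbabilityMeasure μ] {mP mV mW : MeasurableSpace Ω}
    (hP : mP ≤ mV) (hV : mV ≤ m0) (hW : mW ≤ m0) (hindep : ProbabilityTheory.Indep mV mW μ)
    {f : Ω → ℝ} (hfm : Measurable[mV] f) (hf : Integrable f μ)
    (hzero : ∀ s, MeasurableSet[mP] s → ∫ ω in s, f ω ∂μ = 0) :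
    μ[f|mP ⊔ mW] =ᵐ[μ] 0 := by
  have hle : mP ⊔ mW ≤ m0 := sup_le (hP.trans hV) hW
  have key : ∀ s, MeasurableSet[mP ⊔ mW] s → ∫ ω in s, f ω ∂μ = 0 := by
    intro s hs
    induction s, hs using MeasurableSpace.induction_on_inter
      (generateFrom_image2_inter mP mW).symm (isPiSystem_image2_inter mP mW) with
    | empty => simp
    | basic t ht =>
      obtain ⟨B, hB, C, hC, rfl⟩ := ht
      have hB0 : MeasurableSet[m0] B := hV _ (hP _ hB)
      have h1 : Integrable (B.indicator f) μ := hf.indicator hB0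
      have h2 : μ[B.indicator f|mW] =ᵐ[μ] fun _ => 0 := by
        refine (condExp_indep_eq hV hW
          ((hfm.indicator (hP _ hB)).stronglyMeasurable) hindep).trans ?_
        rw [integral_indicator hB0, hzero B hB]
      simp only
      rw [Set.inter_comm, ← setIntegral_indicator hB0, ← setIntegral_condExp hW h1 hC,
        setIntegral_congr_ae (hW _ hC) (h2.mono fun ω hω _ => hω)]
      simp
    | compl t ht ih =>
      have h1 := integral_add_compl (hle _ ht) hf
      have h2 := hzero Set.univ (MeasurableSet.univ (m := mP))
      rw [setIntegral_univ] at h2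
      rw [ih, h2, zero_add] at h1
      exact h1
    | iUnion t hd ht ih =>
      rw [integral_iUnion (fun i => hle _ (ht i)) hd hf.integrableOn]
      simp [ih]
  refine (ae_eq_condExp_of_forall_setIntegral_eq hle hf (fun _ _ _ => integrableOn_zero) ?_
    aestronglyMeasurable_zero).symm
  intro s hs _
  simp [key s hs]

theorem integral_mul_eq_zero_of_condExp [IsProbabilityMeasure μ] {m : MeasurableSpace Ω}
    (hm : m ≤ m0) {Y f : Ω → ℝ} (hY : Measurable[m] Y) (hf : Integrable f μ)
    (hYf : Integrable (fun ω => Y ω * f ω) μ) (h0 : μ[f|m] =ᵐ[μ] 0) :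
    ∫ ω, Y ω * f ω ∂μ = 0 := by
  rw [← integral_condExp hm]
  have h1 : μ[fun ω => Y ω * f ω|m] =ᵐ[μ] Y * μ[f|m] :=
    condExp_mul_of_stronglyMeasurable_left hY.stronglyMeasurable hYf hf
  rw [integral_congr_ae h1, integral_congr_ae (h0.mono fun ω hω => by
    show Y ω * (μ[f|m]) ω = 0
    rw [hω]; simp)]
  simp

end Orthogonality

section QuadraticForms

variable {Ω : Type*} {m0 : MeasurableSpace Ω} {ι : Type*}

/-- `Z` and `M` have the same integrated quadratic form along the random vector `y`. -/
def SameForm (μ : Measure Ω) (y : Ω → ι → ℝ) (Z M : Ω → Matrix ι ι ℝ) : Prop :=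
  ∀ p q, Integrable (fun ω => y ω p * Z ω p q * y ω q) μ ∧
    Integrable (fun ω => y ω p * M ω p q * y ω q) μ ∧
    ∫ ω, y ω p * Z ω p q * y ω q ∂μ = ∫ ω, y ω p * M ω p q * y ω q ∂μ

variable {μ : Measure Ω} {y : Ω → ι → ℝ} {Z M Z' M' : Ω → Matrix ι ι ℝ}

theorem SameForm.add (h : SameForm μ y Z M) (h' : SameForm μ y Z' M') :
    SameForm μ y (fun ω => Z ω + Z' ω) (fun ω => M ω + M' ω) := by
  intro p q
  obtain ⟨h1, h2, h3⟩ := h p q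
  obtain ⟨h1', h2', h3'⟩ := h' p q
  simp only [Matrix.add_apply, mul_add, add_mul]
  exact ⟨h1.add h1', h2.add h2', by rw [integral_add h1 h1', integral_add h2 h2', h3, h3']⟩

theorem SameForm.smul (h : SameForm μ y Z M) (c : ℝ) :
    SameForm μ y (fun ω => c • Z ω) (fun ω => c • M ω) := by
  intro p q
  obtain ⟨h1, h2, h3⟩ := h p q
  simp only [Matrix.smul_apply, smul_eq_mul, mul_left_comm _ c, mul_assoc c]
  exact ⟨h1.const_mul c, h2.const_mul c, by rw [integral_const_mul, integral_const_mul, h3]⟩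

theorem SameForm.sub (h : SameForm μ y Z M) (h' : SameForm μ y Z' M') :
    SameForm μ y (fun ω => Z ω - Z' ω) (fun ω => M ω - M' ω) := by
  have := h.add (h'.smul (-1))
  simpa only [neg_smul, one_smul, ← sub_eq_add_neg] using this

theorem SameForm.sum {κ : Type*} {s : Finset κ} {Z M : κ → Ω → Matrix ι ι ℝ}
    (h : ∀ k ∈ s, SameForm μ y (Z k) (M k)) :
    SameForm μ y (fun ω => ∑ k ∈ s, Z k ω) (fun ω => ∑ k ∈ s, M k ω) := by
  intro p q
  simp only [Matrix.sum_apply, Finset.mul_sum, Finset.sum_mul]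
  have h1 := fun k hk => (h k hk p q).1
  have h2 := fun k hk => (h k hk p q).2.1
  exact ⟨integrable_finsetSum _ h1, integrable_finsetSum _ h2, by
    rw [integral_finsetSum _ h1, integral_finsetSum _ h2]
    exact Finset.sum_congr rfl fun k hk => (h k hk p q).2.2⟩

theorem SameForm.integral_eq [Fintype ι] (h : SameForm μ y Z M) :
    Integrable (fun ω => y ω ⬝ᵥ Z ω *ᵥ y ω) μ ∧
    ∫ ω, y ω ⬝ᵥ Z ω *ᵥ y ω ∂μ = ∫ ω, y ω ⬝ᵥ M ω *ᵥ y ω ∂μ := by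
  simp only [dotProduct, mulVec, Finset.mul_sum, ← mul_assoc]
  have h1 : ∀ p, Integrable (fun ω => ∑ q, y ω p * Z ω p q * y ω q) μ := fun p =>
    integrable_finsetSum _ fun q _ => (h p q).1
  have h2 : ∀ p, Integrable (fun ω => ∑ q, y ω p * M ω p q * y ω q) μ := fun p =>
    integrable_finsetSum _ fun q _ => (h p q).2.1
  refine ⟨integrable_finsetSum _ fun p _ => h1 p, ?_⟩
  rw [integral_finsetSum _ fun p _ => h1 p, integral_finsetSum _ fun p _ => h2 p]
  refine Finset.sum_congr rfl fun p _ => ?_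
  rw [integral_finsetSum _ fun q _ => (h p q).1, integral_finsetSum _ fun q _ => (h p q).2.1]
  exact Finset.sum_congr rfl fun q _ => (h p q).2.2

/-- A bounded random matrix may be replaced by its conditional expectation. -/
theorem sameForm_of_condExp [IsProbabilityMeasure μ] {m : MeasurableSpace Ω} (hm : m ≤ m0)
    (hym : ∀ p, Measurable[m] fun ω => y ω p) (hy : ∀ p, MemLp (fun ω => y ω p) 2 μ)
    (hM : ∀ p q, Measurable[m0] fun ω => M ω p q) {c : ℝ} (hMc : ∀ᵐ ω ∂μ, ∀ p q, |M ω p q| ≤ c)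
    (hZ : ∀ p q, (fun ω => Z ω p q) =ᵐ[μ] μ[fun ω => M ω p q|m]) :
    SameForm μ y Z M := by
  intro p q
  have hc : ∀ᵐ ω ∂μ, ‖M ω p q‖ ≤ c := hMc.mono fun ω h => h p q
  have hMi : Integrable (fun ω => M ω p q) μ :=
    Integrable.of_bound (hM p q).aestronglyMeasurable c hc
  have hyy : Integrable (fun ω => y ω p * y ω q) μ := (hy p).integrable_mul (hy q)
  have hyyM : Integrable (fun ω => (y ω p * y ω q) * M ω p q) μ :=
    hyy.mul_bdd (c := c) (hM p q).aestronglyMeasurable hc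
  have hce : μ[fun ω => (y ω p * y ω q) * M ω p q|m] =ᵐ[μ]
      (fun ω => y ω p * y ω q) * μ[fun ω => M ω p q|m] :=
    condExp_mul_of_stronglyMeasurable_left
      ((hym p).mul (hym q)).stronglyMeasurable hyyM hMi
  have hZce : (fun ω => y ω p * Z ω p q * y ω q) =ᵐ[μ]
      μ[fun ω => (y ω p * y ω q) * M ω p q|m] := by
    filter_upwards [hce, hZ p q] with ω h1 h2
    rw [h1, h2, Pi.mul_apply]; ring
  have hMeq : (fun ω => y ω p * M ω p q * y ω q) = fun ω => (y ω p * y ω q) * M ω p q := by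
    funext ω; ring
  rw [hMeq]
  exact ⟨integrable_condExp.congr hZce.symm, hyyM, by
    rw [integral_congr_ae hZce, integral_condExp hm]⟩

end QuadraticForms

section EntryMeasurability

variable {Ω : Type*} [MeasurableSpace Ω] {ι : Type*} [Fintype ι]

theorem measurable_mul_entry {M M' : Ω → Matrix ι ι ℝ}
    (hM : ∀ p q, Measurable fun ω => M ω p q) (hM' : ∀ p q, Measurable fun ω => M' ω p q)
    (p q : ι) : Measurable fun ω => (M ω * M' ω) p q := by
  simp only [Matrix.mul_apply]
  exact Finset.measurable_sum _ fun r _ => (hM p r).mul (hM' r q)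

variable [DecidableEq ι]

theorem measurable_det {M : Ω → Matrix ι ι ℝ} (hM : ∀ p q, Measurable fun ω => M ω p q) :
    Measurable fun ω => (M ω).det := by
  simp only [Matrix.det_apply']
  exact Finset.measurable_sum _ fun σ _ =>
    (Finset.measurable_prod _ fun i _ => hM (σ i) i).const_mul _

theorem measurable_inv_entry {M : Ω → Matrix ι ι ℝ} (hM : ∀ p q, Measurable fun ω => M ω p q)
    (p q : ι) : Measurable fun ω => (M ω)⁻¹ p q := by
  simp only [Matrix.inv_def, Ring.inverse_eq_inv', Matrix.smul_apply, smul_eq_mul,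
    Matrix.adjugate_apply]
  refine (measurable_det hM).inv.mul (measurable_det fun i j => ?_)
  simp only [Matrix.updateRow_apply]
  split_ifs
  · exact measurable_const
  · exact hM i j

theorem measurable_phiProdZ_inv_entry {F : ℤ → Ω → Matrix ι ι ℝ} {k : ℤ} {q : ℕ}
    (hF : ∀ j : ℕ, j < q → ∀ p r, Measurable fun ω => F (k - (j + 1)) ω p r) (p r : ι) :
    Measurable fun ω => (phiProdZ (fun t => F t ω) (k - 1) (k - q))⁻¹ p r := by
  induction q generalizing p r with
  | zero => simp only [phiProdZ_inv_zero, measurable_const]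
  | succ q ih =>
    simp only [phiProdZ_inv_succ]
    exact measurable_mul_entry (measurable_inv_entry (hF q (Nat.lt_succ_self q)))
      (fun p r => ih (fun j hj => hF j (by omega)) p r) p r

/-- The delay-elimination matrices are measurable. -/
theorem measurable_delay_recursion {F : ℤ → Ω → Matrix ι ι ℝ} {P : ℕ → Ω → Matrix ι ι ℝ}
    {Q : ℕ → ℕ → Ω → Matrix ι ι ℝ} {b : ℕ → ℝ} {d : ℕ}
    (hstart : ∀ k : ℤ, -(d : ℤ) ≤ k → k ≤ -1 → ∀ ω, F k ω = 1)
    (hrec : ∀ (k : ℕ) ω, F k ω = 1 - (P k ω - b k • ∑ q ∈ Finset.range (d + 1),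
      Q k q ω * (phiProdZ (fun t => F t ω) ((k : ℤ) - 1) ((k : ℤ) - q))⁻¹))
    (hP : ∀ (k : ℕ) p r, Measurable fun ω => P k ω p r)
    (hQ : ∀ k q p r, Measurable fun ω => Q k q ω p r) :
    ∀ k : ℤ, -(d : ℤ) ≤ k → ∀ p r, Measurable fun ω => F k ω p r := by
  have hneg : ∀ k : ℤ, -(d : ℤ) ≤ k → k ≤ -1 → ∀ p r, Measurable fun ω => F k ω p r := by
    intro k h1 h2 p r
    simp only [hstart k h1 h2, measurable_const]
  have hnat : ∀ (k : ℕ) p r, Measurable fun ω => F (k : ℤ) ω p r := by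
    intro k
    induction k using Nat.strong_induction_on with
    | _ k ih =>
      intro p r
      simp only [hrec, Matrix.sub_apply, Matrix.smul_apply, Matrix.sum_apply, smul_eq_mul]
      refine measurable_const.sub ((hP k p r).sub (Measurable.const_mul ?_ _))
      refine Finset.measurable_sum _ fun q hq => ?_
      refine measurable_mul_entry (hQ k q) (measurable_phiProdZ_inv_entry fun j hj => ?_) p r
      have hq' := Finset.mem_range.1 hq
      by_cases hjk : j + 1 ≤ k
      · have : (k : ℤ) - (j + 1) = ((k - (j + 1) : ℕ) : ℤ) := by omega
        rw [this]
        exact ih _ (by omega)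
      · exact hneg _ (by omega) (by omega)
  intro k hk
  by_cases h0 : k ≤ -1
  · exact hneg k hk h0
  · lift k to ℕ using by omega
    exact hnat k

theorem memLp_toEuclideanCLM_apply {μ : Measure Ω} {M : Ω → Matrix ι ι ℝ}
    {f : Ω → EuclideanSpace ℝ ι} {c : ℝ} (hM : ∀ p q, Measurable fun ω => M ω p q)
    (hMc : ∀ᵐ ω ∂μ, ‖toEuclideanCLM (n := ι) (𝕜 := ℝ) (M ω)‖ ≤ c) (hf : MemLp f 2 μ) :
    MemLp (fun ω => toEuclideanCLM (n := ι) (𝕜 := ℝ) (M ω) (f ω)) 2 μ := by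
  refine hf.of_le_mul (c := c) ?_ (hMc.mono fun ω hω =>
    ContinuousLinearMap.le_of_opNorm_le _ hω _)
  have hfc : ∀ q, AEMeasurable (fun ω => f ω q) μ := fun q =>
    (measurable_pi_apply q).comp_aemeasurable
      ((WithLp.measurable_ofLp 2 _).comp_aemeasurable hf.aestronglyMeasurable.aemeasurable)
  have h1 : AEMeasurable (fun ω => M ω *ᵥ (f ω).ofLp) μ := by
    refine aemeasurable_pi_iff.2 fun p => ?_
    simp only [mulVec, dotProduct]
    exact Finset.aemeasurable_fun_sum _ fun q _ => (hM p q).aemeasurable.mul (hfc q)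
  exact ((WithLp.measurable_toLp 2 _).comp_aemeasurable h1).aestronglyMeasurable

theorem abs_entry_le_norm (M : Matrix ι ι ℝ) (p q : ι) :
    |M p q| ≤ ‖toEuclideanCLM (n := ι) (𝕜 := ℝ) M‖ := by
  have h1 : (toEuclideanCLM (n := ι) (𝕜 := ℝ) M (EuclideanSpace.single q 1)) p = M p q := by
    simp [ofLp_toEuclideanCLM]
  rw [← h1, ← Real.norm_eq_abs]
  refine (PiLp.norm_apply_le _ p).trans ((ContinuousLinearMap.le_opNorm _ _).trans ?_)
  simp

end EntryMeasurability

section NetworkMeasurability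

variable {Ω : Type*} [MeasurableSpace Ω] {N n : ℕ} {ni : Fin N → ℕ}

theorem measurable_kronecker_one_entry {M : Ω → Matrix (Fin N) (Fin N) ℝ}
    (hM : ∀ i j, Measurable fun ω => M ω i j) (p q : Fin N × Fin n) :
    Measurable fun ω => (M ω ⊗ₖ (1 : Matrix (Fin n) (Fin n) ℝ)) p q := by
  simp only [kroneckerMap_apply]
  exact (hM _ _).mul_const _

theorem measurable_degMat_entry {A : Ω → Matrix (Fin N) (Fin N) ℝ}
    (hA : ∀ i j, Measurable fun ω => A ω i j) (i j : Fin N) :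
    Measurable fun ω => degMat (A ω) i j := by
  simp only [degMat, diagonal_apply]
  split_ifs
  · exact Finset.measurable_sum _ fun r _ => hA i r
  · exact measurable_const

theorem measurable_symmLapl_entry {A : Ω → Matrix (Fin N) (Fin N) ℝ}
    (hA : ∀ i j, Measurable fun ω => A ω i j) (i j : Fin N) :
    Measurable fun ω => symmLapl (A ω) i j := by
  simp only [symmLapl, lapl, Matrix.smul_apply, Matrix.add_apply, transpose_apply,
    Matrix.sub_apply, smul_eq_mul]
  exact (((measurable_degMat_entry hA i j).sub (hA i j)).add
    ((measurable_degMat_entry hA j i).sub (hA j i))).const_mul _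

theorem measurable_blockHtH_entry {H : ∀ i : Fin N, Ω → Matrix (Fin (ni i)) (Fin n) ℝ}
    (hH : ∀ i p c, Measurable fun ω => H i ω p c) (p q : Fin N × Fin n) :
    Measurable fun ω => blockHtH (fun i => H i ω) p q := by
  simp only [blockHtH, of_apply]
  split_ifs
  · simp only [Matrix.mul_apply, transpose_apply]
    exact Finset.measurable_sum _ fun r _ => (hH _ _ _).mul (hH _ _ _)
  · exact measurable_const

theorem measurable_delayAdj_entry {A : Ω → Matrix (Fin N) (Fin N) ℝ}
    {lam : Fin N → Fin N → Ω → ℕ} (hA : ∀ i j, Measurable fun ω => A ω i j)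
    (hlam : ∀ j i, Measurable (lam j i)) (r : ℕ) (p q : Fin N × Fin n) :
    Measurable fun ω => delayAdj n (A ω) (fun j i => lam j i ω) r p q := by
  refine measurable_kronecker_one_entry (fun i j => ?_) p q
  simp only [hadamard_apply, delayMat, of_apply]
  exact (hA i j).mul (Measurable.ite (hlam j i (measurableSet_singleton r))
    measurable_const measurable_const)

theorem abs_symmLapl_entry_le {A : Matrix (Fin N) (Fin N) ℝ} {β : ℝ}
    (hA : ∀ i j, |A i j| ≤ β) (i j : Fin N) : |symmLapl A i j| ≤ N * β + β := by
  have hβ : 0 ≤ β := (abs_nonneg _).trans (hA i j)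
  have hdeg : ∀ i j, |degMat A i j| ≤ N * β := by
    intro i j
    simp only [degMat, diagonal_apply]
    split_ifs
    · refine (Finset.abs_sum_le_sum_abs _ _).trans ?_
      calc ∑ j, |A i j| ≤ ∑ _j : Fin N, β := Finset.sum_le_sum fun j _ => hA i j
        _ = N * β := by simp
    · simpa using by positivity
  have hlap : ∀ i j, |lapl A i j| ≤ N * β + β := fun i j =>
    (abs_sub _ _).trans (add_le_add (hdeg i j) (hA i j))
  simp only [symmLapl, Matrix.smul_apply, Matrix.add_apply, transpose_apply, smul_eq_mul]
  rw [abs_mul, abs_of_pos (by norm_num : (0 : ℝ) < 2⁻¹)]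
  have := (abs_add_le (lapl A i j) (lapl A j i)).trans (add_le_add (hlap i j) (hlap j i))
  linarith

theorem measurable_stackedNoise {H : ∀ i : Fin N, Ω → Matrix (Fin (ni i)) (Fin n) ℝ}
    {v : Ω → ∀ i : Fin N, Fin (ni i) → ℝ} (hH : ∀ i p c, Measurable fun ω => H i ω p c)
    (hv : ∀ i p, Measurable fun ω => v ω i p) :
    Measurable fun ω => stackedNoise (fun i => H i ω) (v ω) := by
  refine (WithLp.measurable_toLp 2 _).comp (measurable_pi_iff.2 fun ic => ?_)
  simp only [mulVec, dotProduct, transpose_apply]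
  exact Finset.measurable_sum _ fun r _ => (hH _ _ _).mul (hv _ _)

/-- One step of the delayed algorithm preserves measurability. -/
theorem measurable_delayed_update {H : ∀ i : Fin N, Ω → Matrix (Fin (ni i)) (Fin n) ℝ}
    {v : Ω → ∀ i : Fin N, Fin (ni i) → ℝ} {A : Ω → Matrix (Fin N) (Fin N) ℝ}
    {lam : Fin N → Fin N → Ω → ℕ} {d : ℕ} {x : ℤ → Fin N → Ω → Fin n → ℝ} {k : ℤ}
    {x0 : Fin n → ℝ} {a b : ℝ} (hH : ∀ i p c, Measurable fun ω => H i ω p c)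
    (hv : ∀ i p, Measurable fun ω => v ω i p) (hA : ∀ i j, Measurable fun ω => A ω i j)
    (hlam : ∀ j i, Measurable (lam j i)) (hlamd : ∀ j i ω, lam j i ω ≤ d)
    (hx : ∀ q : ℕ, q ≤ d → ∀ i p, Measurable fun ω => x (k - q) i ω p)
    (i : Fin N) (p : Fin n) :
    Measurable fun ω => x k i ω p
        + a * ((H i ω)ᵀ.mulVec
            (((H i ω).mulVec x0 + v ω i) - (H i ω).mulVec (x k i ω))) p
        + b * ∑ j, A ω i j * (x (k - (lam j i ω : ℤ)) j ω p - x k i ω p) := by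
  have hxk : ∀ i p, Measurable fun ω => x k i ω p := by simpa using hx 0 (Nat.zero_le d)
  have hdel : ∀ j, Measurable fun ω => x (k - (lam j i ω : ℤ)) j ω p := by
    intro j
    have h1 : (fun ω => x (k - (lam j i ω : ℤ)) j ω p) = fun ω =>
        ∑ q ∈ Finset.range (d + 1), if lam j i ω = q then x (k - (q : ℤ)) j ω p else 0 := by
      funext ω
      rw [Finset.sum_ite_eq, if_pos (Finset.mem_range.2 (Nat.lt_succ_of_le (hlamd j i ω)))]
    rw [h1]
    refine Finset.measurable_sum _ fun q hq => ?_
    exact Measurable.ite (hlam j i (measurableSet_singleton q))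
      (hx q (Nat.lt_succ_iff.1 (Finset.mem_range.1 hq)) j p) measurable_const
  refine ((hxk i p).add (Measurable.const_mul ?_ a)).add (Measurable.const_mul ?_ b)
  · simp only [mulVec, dotProduct, transpose_apply, Pi.sub_apply, Pi.add_apply]
    refine Finset.measurable_sum _ fun r _ => (hH i r p).mul (Measurable.sub ?_ ?_)
    · exact (Finset.measurable_sum _ fun c _ => (hH i r c).mul_const _).add (hv i r)
    · exact Finset.measurable_sum _ fun c _ => (hH i r c).mul (hxk i c)
  · exact Finset.measurable_sum _ fun j _ => (hA i j).mul ((hdel j).sub (hxk i p))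

end NetworkMeasurability

theorem gain_bounds_of_lt_min {b : ℕ → ℝ} {B κ p q r : ℝ} {d : ℕ} (hκ0 : 0 < κ) (hκ1 : κ < 1)
    (hp : 0 < p) (hq : 0 < q) (hr : 0 < r) (hb0 : ∀ k, 0 < b k) (hbB : ∀ k, b k ≤ B)
    (hB : B < min (κ / (2 * (p + q + r)))
      ((1 - (1 - κ)⁻¹) * κ / (2 * q * (1 - (1 - κ) ^ (-(d + 1 : ℤ)))))) (k : ℕ) :
    b k * (p + r) ≤ κ / 2 ∧
      b k * (q * ∑ i ∈ Finset.range (d + 1), (1 - κ)⁻¹ ^ i) ≤ κ / 2 := by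
  obtain ⟨h1, h2⟩ := lt_min_iff.1 ((hbB k).trans_lt hB)
  have hbk := hb0 k
  constructor
  · rw [lt_div_iff₀ (by positivity)] at h1
    nlinarith [mul_pos hbk hq]
  · have hpow : (1 - κ) ^ (-(d + 1 : ℤ)) = (1 - κ)⁻¹ ^ (d + 1) := by
      rw [_root_.zpow_neg, inv_pow]
      norm_cast
    have hρ : 1 < (1 - κ)⁻¹ := (one_lt_inv₀ (by linarith)).2 (by linarith)
    rw [hpow] at h2
    set ρ := (1 - κ)⁻¹ with hρdef
    set S := ∑ i ∈ Finset.range (d + 1), ρ ^ i with hS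
    have hS0 : 0 < S := Finset.sum_pos (fun i _ => by positivity) ⟨0, by simp⟩
    have hgeom : 1 - ρ ^ (d + 1) = (1 - ρ) * S := by
      rw [hS, ← neg_sub (ρ ^ (d + 1)) 1, ← geom_sum_mul]; ring
    rw [hgeom, show 2 * q * ((1 - ρ) * S) = (1 - ρ) * (2 * q * S) by ring,
      mul_div_mul_left _ _ (by linarith : 1 - ρ ≠ 0), lt_div_iff₀ (by positivity)] at h2
    nlinarith

section Filtration

variable {Ω : Type*} {N n : ℕ} {ni : Fin N → ℕ}
  {H : ℕ → ∀ i : Fin N, Ω → Matrix (Fin (ni i)) (Fin n) ℝ}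
  {v : ℕ → Ω → ∀ i : Fin N, Fin (ni i) → ℝ}
  {A : ℕ → Ω → Matrix (Fin N) (Fin N) ℝ}
  {lam : ℕ → Fin N → Fin N → Ω → ℕ}

theorem sigBeforeD_mono : Monotone (sigBeforeD H v A lam) := fun _ _ hkl =>
  iSup₂_le fun s hs => le_iSup₂_of_le s (hs.trans_le hkl) le_rfl

theorem measurable_sigBeforeD_obs {s k : ℕ} (hs : s < k) (i : Fin N) (p : Fin (ni i))
    (c : Fin n) : Measurable[sigBeforeD H v A lam k] fun ω => H s i ω p c := by
  have h1 : Measurable[sigBeforeD H v A lam k]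
      (fun ω (i : Fin N) (p : Fin (ni i)) (c : Fin n) => H s i ω p c) :=
    Measurable.of_comap_le (le_iSup₂_of_le s hs
      (le_sup_left.trans (le_sup_left.trans le_sup_left)))
  exact (measurable_pi_apply c).comp
    ((measurable_pi_apply p).comp ((measurable_pi_apply i).comp h1))

theorem measurable_sigBeforeD_noise {s k : ℕ} (hs : s < k) (i : Fin N) (p : Fin (ni i)) :
    Measurable[sigBeforeD H v A lam k] fun ω => v s ω i p := by
  have h1 : Measurable[sigBeforeD H v A lam k] (v s) :=
    Measurable.of_comap_le (le_iSup₂_of_le s hs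
      (le_sup_right.trans (le_sup_left.trans le_sup_left)))
  exact (measurable_pi_apply p).comp ((measurable_pi_apply i).comp h1)

theorem measurable_sigBeforeD_adj {s k : ℕ} (hs : s < k) (i j : Fin N) :
    Measurable[sigBeforeD H v A lam k] fun ω => A s ω i j := by
  have h1 : Measurable[sigBeforeD H v A lam k] (fun ω (i j : Fin N) => A s ω i j) :=
    Measurable.of_comap_le (le_iSup₂_of_le s hs (le_sup_right.trans le_sup_left))
  exact (measurable_pi_apply j).comp ((measurable_pi_apply i).comp h1)

theorem measurable_sigBeforeD_delay {s k : ℕ} (hs : s < k) (j i : Fin N) :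
    Measurable[sigBeforeD H v A lam k] (lam s j i) := by
  have h1 : Measurable[sigBeforeD H v A lam k] (fun ω (j i : Fin N) => lam s j i ω) :=
    Measurable.of_comap_le (le_iSup₂_of_le s hs le_sup_right)
  exact (measurable_pi_apply i).comp ((measurable_pi_apply j).comp h1)

theorem sigBeforeD_le {m0 : MeasurableSpace Ω}
    (hH : ∀ k, Measurable (fun ω (i : Fin N) (p : Fin (ni i)) (c : Fin n) => H k i ω p c))
    (hv : ∀ k, Measurable (v k))
    (hA : ∀ k, Measurable (fun ω (i j : Fin N) => A k ω i j))
    (hlam : ∀ k, Measurable (fun ω (j i : Fin N) => lam k j i ω)) (k : ℕ) :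
    sigBeforeD H v A lam k ≤ m0 :=
  iSup₂_le fun s _ => sup_le (sup_le (sup_le (hH s).comap_le (hv s).comap_le) (hA s).comap_le)
    (hlam s).comap_le

/-- The estimates are adapted to the past of the algorithm. -/
theorem measurable_estimate {d : ℕ} {x : ℤ → Fin N → Ω → Fin n → ℝ} {x0 : Fin n → ℝ}
    {a b : ℕ → ℝ} (hlamd : ∀ k j i ω, lam k j i ω ≤ d)
    (hxinit : ∀ s : ℤ, -(d : ℤ) ≤ s → s ≤ 0 → ∀ i, ∃ c : Fin n → ℝ, ∀ ω, x s i ω = c)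
    (hrec : ∀ (k : ℕ) (i : Fin N) (ω : Ω), x ((k : ℤ) + 1) i ω = fun p =>
      x (k : ℤ) i ω p
        + a k * ((H k i ω)ᵀ.mulVec
            (((H k i ω).mulVec x0 + v k ω i) - (H k i ω).mulVec (x (k : ℤ) i ω))) p
        + b k * ∑ j, A k ω i j * (x ((k : ℤ) - (lam k j i ω : ℤ)) j ω p - x (k : ℤ) i ω p))
    (k : ℕ) : ∀ s : ℤ, -(d : ℤ) ≤ s → s ≤ k → ∀ i p,
      Measurable[sigBeforeD H v A lam k] fun ω => x s i ω p := by
  induction k with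
  | zero =>
    intro s h1 h2 i p
    obtain ⟨c, hc⟩ := hxinit s h1 (by simpa using h2) i
    simp only [hc]
    exact measurable_const
  | succ k ih =>
    intro s h1 h2 i p
    rcases (show s ≤ k ∨ s = (k : ℤ) + 1 by push_cast at h2; omega) with h3 | rfl
    · exact (ih s h1 h3 i p).mono (sigBeforeD_mono (Nat.le_succ k)) le_rfl
    · simp only [hrec]
      have hk := Nat.lt_succ_self k
      exact @measurable_delayed_update Ω (sigBeforeD H v A lam (k + 1)) N n ni (H k) (v k) (A k)
        (lam k) d x k x0 (a k) (b k) (measurable_sigBeforeD_obs hk)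
        (measurable_sigBeforeD_noise hk) (measurable_sigBeforeD_adj hk)
        (measurable_sigBeforeD_delay hk) (hlamd k)
        (fun q hq i p => (ih _ (by omega) (by omega) i p).mono
          (sigBeforeD_mono (Nat.le_succ k)) le_rfl) i p

/-- The noise is orthogonal to everything that depends on the past and on the current
observation matrices. -/
theorem integral_past_mul_noise_eq_zero {m0 : MeasurableSpace Ω} {μ : Measure Ω}
    [IsProbabilityMeasure μ]
    (hHmeas : ∀ k, Measurable (fun ω (i : Fin N) (p : Fin (ni i)) (c : Fin n) => H k i ω p c))
    (hvmeas : ∀ k, Measurable (v k))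
    (hAmeas : ∀ k, Measurable (fun ω (i j : Fin N) => A k ω i j))
    (hlammeas : ∀ k, Measurable (fun ω (j i : Fin N) => lam k j i ω))
    (hA1a : ProbabilityTheory.IndepFun
      (fun ω => fun k => v k ω)
      (fun ω => fun k =>
        ((fun (i : Fin N) (p : Fin (ni i)) (c : Fin n) => H k i ω p c),
         (fun (i j : Fin N) => A k ω i j),
         (fun (j i : Fin N) => lam k j i ω))) μ)
    (hA1b1 : ∀ k i p, (μ[(fun ω => v k ω i p)|sigBeforeD H v A lam k]) =ᵐ[μ] 0)
    {k : ℕ} {i : Fin N} {p : Fin (ni i)} (hvint : Integrable (fun ω => v k ω i p) μ)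
    {y : Ω → ℝ} (hy : Measurable[sigBeforeD H v A lam k] y) (c : Fin n)
    (hInt : Integrable (fun ω => y ω * H k i ω p c * v k ω i p) μ) :
    ∫ ω, y ω * H k i ω p c * v k ω i p ∂μ = 0 := by
  set W : Ω → ℕ → (∀ i : Fin N, Fin (ni i) → Fin n → ℝ) × (Fin N → Fin N → ℝ) ×
      (Fin N → Fin N → ℕ) := fun ω => fun k =>
        ((fun (i : Fin N) (p : Fin (ni i)) (c : Fin n) => H k i ω p c),
         (fun (i j : Fin N) => A k ω i j),
         (fun (j i : Fin N) => lam k j i ω)) with hWdef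
  have hVm : Measurable fun ω => fun k => v k ω := measurable_pi_iff.2 hvmeas
  have hWm : Measurable W := measurable_pi_iff.2 fun s =>
    (hHmeas s).prodMk ((hAmeas s).prodMk (hlammeas s))
  set mV : MeasurableSpace Ω := MeasurableSpace.comap (fun ω => fun k => v k ω) inferInstance
  set mW : MeasurableSpace Ω := MeasurableSpace.comap W inferInstance
  set mP : MeasurableSpace Ω := ⨆ s, ⨆ _ : s < k, MeasurableSpace.comap (v s) inferInstance
  have hvV : ∀ s, Measurable[mV] (v s) := fun s =>
    (measurable_pi_apply s).comp (comap_measurable (fun ω => fun k => v k ω))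
  have hWs : ∀ s, Measurable[mW] fun ω => W ω s := fun s =>
    (measurable_pi_apply s).comp (comap_measurable W)
  have hP : mP ≤ mV := iSup₂_le fun s _ => (hvV s).comap_le
  have hV : mV ≤ m0 := hVm.comap_le
  have hW : mW ≤ m0 := hWm.comap_le
  have hPsig : mP ≤ sigBeforeD H v A lam k := iSup₂_le fun s hs =>
    le_iSup₂_of_le s hs (le_sup_right.trans (le_sup_left.trans le_sup_left))
  have hsig : sigBeforeD H v A lam k ≤ mP ⊔ mW := by
    refine iSup₂_le fun s hs => sup_le (sup_le (sup_le ?_ ?_) ?_) ?_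
    · exact (hWs s).fst.comap_le.trans le_sup_right
    · exact (le_iSup₂_of_le s hs le_rfl : _ ≤ mP).trans le_sup_left
    · exact (hWs s).snd.fst.comap_le.trans le_sup_right
    · exact (hWs s).snd.snd.comap_le.trans le_sup_right
  have hle := sigBeforeD_le hHmeas hvmeas hAmeas hlammeas k
  have hHW : Measurable[mP ⊔ mW] fun ω => H k i ω p c :=
    (((measurable_pi_apply c).comp ((measurable_pi_apply p).comp
      ((measurable_pi_apply i).comp (hWs k).fst)))).mono le_sup_right le_rfl
  refine integral_mul_eq_zero_of_condExp (sup_le (hP.trans hV) hW)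
    ((hy.mono hsig le_rfl).mul hHW) hvint hInt ?_
  refine condExp_sup_eq_zero hP hV hW hA1a
    ((measurable_pi_apply p).comp ((measurable_pi_apply i).comp (hvV k))) hvint fun s hs => ?_
  rw [← setIntegral_condExp hle hvint (hPsig s hs), integral_congr_ae
    (ae_restrict_of_ae (hA1b1 k i p))]
  simp

end Filtration

theorem inner_toEuclideanCLM_self {ι : Type*} [Fintype ι] [DecidableEq ι] (M : Matrix ι ι ℝ)
    (y : EuclideanSpace ℝ ι) :
    inner ℝ y (toEuclideanCLM (n := ι) (𝕜 := ℝ) M y) = y.ofLp ⬝ᵥ M *ᵥ y.ofLp := by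
  simp [PiLp.inner_apply, dotProduct, mul_comm, ofLp_toEuclideanCLM]

theorem inner_stackedError_stackedNoise {N n : ℕ} {ni : Fin N → ℕ} (X : Fin N → Fin n → ℝ)
    (x0 : Fin n → ℝ) (H : ∀ i : Fin N, Matrix (Fin (ni i)) (Fin n) ℝ)
    (v : ∀ i : Fin N, Fin (ni i) → ℝ) :
    inner ℝ (stackedError X x0) (stackedNoise H v) =
      ∑ i, ∑ c, ∑ p, (X i c - x0 c) * H i p c * v i p := by
  rw [PiLp.inner_apply, Fintype.sum_prod_type]
  simp only [stackedError, stackedNoise, RCLike.inner_apply, conj_trivial, mulVec, dotProduct,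
    transpose_apply, Finset.sum_mul]
  refine Finset.sum_congr rfl fun i _ => Finset.sum_congr rfl fun c _ =>
    Finset.sum_congr rfl fun p _ => by ring

theorem abs_entry_le_specNorm {p q : Type*} [Fintype p] [Fintype q] [DecidableEq q]
    {A : Matrix p q ℝ} {β : ℝ} (hβ : 0 ≤ β) (hA : specNorm A ≤ β) (i : p) (j : q) :
    |A i j| ≤ β := by
  have h := sum_mulVec_sq_le hA (Pi.single j 1)
  have h1 : ∑ l : q, (Pi.single j 1 : q → ℝ) l ^ 2 = 1 := by
    simp [Pi.single_apply, ite_pow]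
  rw [h1, mul_one] at h
  refine abs_le_of_sq_le_sq ?_ hβ
  calc A i j ^ 2 = (A *ᵥ Pi.single j 1) i ^ 2 := by simp
    _ ≤ _ := Finset.single_le_sum (f := fun i => (A *ᵥ Pi.single j 1) i ^ 2)
        (fun _ _ => sq_nonneg _) (Finset.mem_univ i)
    _ ≤ _ := h

theorem norm_mul_sub_one_le {ι : Type*} [Fintype ι] [DecidableEq ι] {M Ψ : Matrix ι ι ℝ}
    {c c' : ℝ} (hM : ‖toEuclideanCLM (n := ι) (𝕜 := ℝ) M‖ ≤ c)
    (hΨ : ‖toEuclideanCLM (n := ι) (𝕜 := ℝ) Ψ‖ ≤ c') :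
    ‖toEuclideanCLM (n := ι) (𝕜 := ℝ) (M * (Ψ - 1))‖ ≤ c * (c' + 1) := by
  rw [map_mul, map_sub, map_one]
  refine (norm_mul_le _ _).trans (mul_le_mul hM ?_ (norm_nonneg _) ((norm_nonneg _).trans hM))
  exact (norm_sub_le _ _).trans (add_le_add hΨ ContinuousLinearMap.norm_id_le)

section Orthogonality

variable {Ω : Type*} {N n : ℕ} {ni : Fin N → ℕ}
  {H : ℕ → ∀ i : Fin N, Ω → Matrix (Fin (ni i)) (Fin n) ℝ}
  {v : ℕ → Ω → ∀ i : Fin N, Fin (ni i) → ℝ}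
  {A : ℕ → Ω → Matrix (Fin N) (Fin N) ℝ}
  {lam : ℕ → Fin N → Fin N → Ω → ℕ}

theorem integral_inner_stackedError_stackedNoise_eq_zero {m0 : MeasurableSpace Ω}
    {μ : Measure Ω} [IsProbabilityMeasure μ]
    (hHmeas : ∀ k, Measurable (fun ω (i : Fin N) (p : Fin (ni i)) (c : Fin n) => H k i ω p c))
    (hvmeas : ∀ k, Measurable (v k))
    (hAmeas : ∀ k, Measurable (fun ω (i j : Fin N) => A k ω i j))
    (hlammeas : ∀ k, Measurable (fun ω (j i : Fin N) => lam k j i ω))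
    (hA1a : ProbabilityTheory.IndepFun
      (fun ω => fun k => v k ω)
      (fun ω => fun k =>
        ((fun (i : Fin N) (p : Fin (ni i)) (c : Fin n) => H k i ω p c),
         (fun (i j : Fin N) => A k ω i j),
         (fun (j i : Fin N) => lam k j i ω))) μ)
    (hA1b1 : ∀ k i p, (μ[(fun ω => v k ω i p)|sigBeforeD H v A lam k]) =ᵐ[μ] 0)
    {k : ℕ} {β : ℝ} (hβ : 0 ≤ β) (hH : ∀ᵐ ω ∂μ, ∀ i, specNorm (H k i ω) ≤ β)
    (hv : ∀ i p, MemLp (fun ω => v k ω i p) 2 μ)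
    {X : Fin N → Ω → Fin n → ℝ} {x0 : Fin n → ℝ}
    (hXm : ∀ i c, Measurable[sigBeforeD H v A lam k] fun ω => X i ω c)
    (hX : ∀ i c, MemLp (fun ω => X i ω c - x0 c) 2 μ) :
    ∫ ω, inner ℝ (stackedError (fun i => X i ω) x0)
      (stackedNoise (fun i => H k i ω) (v k ω)) ∂μ = 0 := by
  have hInt : ∀ i c p,
      Integrable (fun ω => (X i ω c - x0 c) * H k i ω p c * v k ω i p) μ := by
    intro i c p
    have hHm : Measurable fun ω => H k i ω p c := (measurable_pi_apply c).comp
      ((measurable_pi_apply p).comp ((measurable_pi_apply i).comp (hHmeas k)))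
    refine (((hX i c).integrable_mul (hv i p)).bdd_mul hHm.aestronglyMeasurable
      (c := β) ?_).congr (ae_of_all _ fun ω => ?_)
    · filter_upwards [hH] with ω hω
      exact abs_entry_le_specNorm hβ (hω i) p c
    · simp only [Pi.mul_apply]; ring
  simp only [inner_stackedError_stackedNoise]
  rw [integral_finsetSum _ fun i _ => integrable_finsetSum _ fun c _ =>
    integrable_finsetSum _ fun p _ => hInt i c p]
  refine Finset.sum_eq_zero fun i _ => ?_
  rw [integral_finsetSum _ fun c _ => integrable_finsetSum _ fun p _ => hInt i c p]
  refine Finset.sum_eq_zero fun c _ => ?_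
  rw [integral_finsetSum _ fun p _ => hInt i c p]
  exact Finset.sum_eq_zero fun p _ => integral_past_mul_noise_eq_zero hHmeas hvmeas hAmeas
    hlammeas hA1a hA1b1 ((hv i p).integrable (by norm_num)) ((hXm i c).sub_const _) c
    (hInt i c p)

end Orthogonality

/-- The excitation condition on the conditional expectations, integrated against a random
vector measurable with respect to the conditioning σ-algebra. -/
theorem mul_integral_sum_sq_le_of_excitation {Ω : Type*} {m m0 : MeasurableSpace Ω}
    {μ : Measure Ω} [IsProbabilityMeasure μ] {N n d : ℕ} (hm : m ≤ m0)
    {y : Ω → Fin N × Fin n → ℝ} (hym : ∀ p, Measurable[m] fun ω => y ω p)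
    (hy : ∀ p, MemLp (fun ω => y ω p) 2 μ)
    {A : ℕ → Ω → Matrix (Fin N) (Fin N) ℝ} {lam : ℕ → Fin N → Fin N → Ω → ℕ}
    {L : ℕ → Ω → Matrix (Fin N × Fin n) (Fin N × Fin n) ℝ}
    {Ψ : ℕ → ℕ → Ω → Matrix (Fin N × Fin n) (Fin N × Fin n) ℝ}
    (hA : ∀ k i j, Measurable fun ω => A k ω i j)
    (hlam : ∀ k j i, Measurable (lam k j i)) (hlamd : ∀ k j i ω, lam k j i ω ≤ d)
    (hL : ∀ k p q, Measurable fun ω => L k ω p q)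
    (hΨ : ∀ k q, q ≤ d → ∀ p r, Measurable fun ω => Ψ k q ω p r)
    {βa cL cΨ : ℝ} (hAc : ∀ᵐ ω ∂μ, ∀ k i j, |A k ω i j| ≤ βa)
    (hLc : ∀ᵐ ω ∂μ, ∀ k p q, |L k ω p q| ≤ cL)
    (hΨc : ∀ᵐ ω ∂μ, ∀ k q, q ≤ d → ∀ p r,
      |(delayAdj n (A k ω) (fun j i => lam k j i ω) q * (Ψ k q ω - 1)) p r| ≤ cΨ)
    {a b : ℕ → ℝ} (ha : ∀ k, a k ≠ 0) {θ : ℝ} (hθ : 0 < θ) {S : Finset ℕ}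
    (hpe : ∀ᵐ ω ∂μ, θ ≤ lambdaMin (∑ k ∈ S,
      ((2 * (b k / a k)) •
          (cexpM μ m (fun ω' => symmLapl (A k ω')) ω ⊗ₖ (1 : Matrix (Fin n) (Fin n) ℝ))
        + (2 : ℝ) • cexpM μ m (L k) ω
        - (b k / a k) • ∑ q ∈ Finset.range (d + 1), cexpM μ m
            (fun ω' => delayAdj n (A k ω') (fun j i => lam k j i ω') q * (Ψ k q ω' - 1)) ω
        - (b k / a k) • ∑ q ∈ Finset.range (d + 1), cexpM μ m
            (fun ω' => (Ψ k q ω' - 1)ᵀ *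
              (delayAdj n (A k ω') (fun j i => lam k j i ω') q)ᵀ) ω))) :
    θ * ∫ ω, ∑ p, y ω p ^ 2 ∂μ ≤ ∑ k ∈ S, 2 / a k * ∫ ω, y ω ⬝ᵥ
      (b k • (degMat (A k ω) ⊗ₖ (1 : Matrix (Fin n) (Fin n) ℝ)) + a k • L k ω
        - b k • ∑ q ∈ Finset.range (d + 1),
          delayAdj n (A k ω) (fun j i => lam k j i ω) q * Ψ k q ω) *ᵥ y ω ∂μ := by
  have hD : ∀ k q, q ≤ d → ∀ p r, Measurable fun ω =>
      (delayAdj n (A k ω) (fun j i => lam k j i ω) q * (Ψ k q ω - 1)) p r := fun k q hq =>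
    measurable_mul_entry (fun p r => measurable_delayAdj_entry (hA k) (hlam k) q p r)
      fun p r => (hΨ k q hq p r).sub_const _
  have hform := fun k => (((sameForm_of_condExp (μ := μ) (y := y) (c := N * βa + βa)
      (Z := fun ω => cexpM μ m (fun ω' => symmLapl (A k ω')) ω
        ⊗ₖ (1 : Matrix (Fin n) (Fin n) ℝ))
      (M := fun ω => symmLapl (A k ω) ⊗ₖ (1 : Matrix (Fin n) (Fin n) ℝ)) hm hym hy
      (measurable_kronecker_one_entry (measurable_symmLapl_entry (hA k)))
      (by
        filter_upwards [hAc] with ω hω p q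
        have h1 := abs_symmLapl_entry_le (hω k) p.1 q.1
        have h0 := (abs_nonneg _).trans h1
        rw [kroneckerMap_apply, one_apply]
        split_ifs <;> simpa)
      (by
        intro p q
        by_cases hpq : p.2 = q.2
        · simp only [kroneckerMap_apply, one_apply, hpq, if_true, mul_one]
          exact EventuallyEq.rfl
        · simp only [kroneckerMap_apply, one_apply, hpq, if_false, mul_zero]
          rw [condExp_const (μ := μ) hm (0 : ℝ)])).smul
            (2 * (b k / a k))).add
    ((sameForm_of_condExp (μ := μ) (y := y) (Z := cexpM μ m (L k)) hm hym hy (hL k)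
      (hLc.mono fun ω hω => hω k) fun p q => EventuallyEq.rfl).smul 2)).sub
    ((SameForm.sum (s := Finset.range (d + 1)) fun q hq =>
      sameForm_of_condExp (μ := μ) (y := y) hm hym hy
        (hD k q (Finset.mem_range_succ_iff.1 hq))
        (hΨc.mono fun ω hω => hω k q (Finset.mem_range_succ_iff.1 hq))
        (Z := cexpM μ m _) fun p q => EventuallyEq.rfl).smul (b k / a k)) |>.sub
    ((SameForm.sum (s := Finset.range (d + 1)) fun q hq =>
      sameForm_of_condExp (μ := μ) (y := y) (c := cΨ)
        (M := fun ω => (Ψ k q ω - 1)ᵀ * (delayAdj n (A k ω) (fun j i => lam k j i ω) q)ᵀ)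
        (Z := cexpM μ m _) hm hym hy
        (fun p r => by
          simp only [← transpose_mul, transpose_apply]
          exact hD k q (Finset.mem_range_succ_iff.1 hq) r p)
        (hΨc.mono fun ω hω p r => by
          simp only [← transpose_mul, transpose_apply]
          exact hω k q (Finset.mem_range_succ_iff.1 hq) r p)
        fun p q => EventuallyEq.rfl).smul (b k / a k))
  have hle := integral_mono_ae ((integrable_finsetSum _ fun p _ =>
    (hy p).integrable_sq).const_mul θ) (integrable_finsetSum S fun k _ => (hform k).integral_eq.1)
    (hpe.mono fun ω hω => (mul_sum_sq_le_of_le_lambdaMin hθ hω (y ω)).trans_eq (by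
      rw [sum_mulVec, dotProduct_sum]))
  rw [integral_const_mul, integral_finsetSum S fun k _ => (hform k).integral_eq.1] at hle
  refine hle.trans_eq (Finset.sum_congr rfl fun k _ => ?_)
  rw [(hform k).integral_eq.2, ← integral_const_mul]
  refine integral_congr_ae (ae_of_all _ fun ω => ?_)
  exact excitation_quadratic_form (fun j i => hlamd k j i ω) (ha k) (L k ω)
    (fun q => Ψ k q ω) (y ω)

/-- **Theorem 3 (case with random time-varying communication delays, mean square
convergence).**  Under Assumptions (A1.a), (A1.b), (A2.b), (A3.a), (A3.c) and
`inf_{m≥0} λ′_m^h ≥ θ > 0` a.s., the distributed estimation algorithm with random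
observation matrices, communication graphs and time-delays converges in mean square. -/
theorem delayed_mean_square_convergence
    {Ω : Type*} [MeasurableSpace Ω] (μ : Measure Ω) [IsProbabilityMeasure μ]
    (N n : ℕ) (hN : 1 ≤ N) (hn : 1 ≤ n) (d : ℕ) (hd : 1 ≤ d)
    (ni : Fin N → ℕ) (hni : ∀ i, 1 ≤ ni i ∧ ni i ≤ n)
    -- the random observation matrices, noises, adjacency matrices and delays
    (H : ℕ → ∀ i : Fin N, Ω → Matrix (Fin (ni i)) (Fin n) ℝ)
    (v : ℕ → Ω → ∀ i : Fin N, Fin (ni i) → ℝ)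
    (A : ℕ → Ω → Matrix (Fin N) (Fin N) ℝ)
    (lam : ℕ → Fin N → Fin N → Ω → ℕ)
    (hHmeas : ∀ k, Measurable (fun ω (i : Fin N) (p : Fin (ni i)) (c : Fin n) => H k i ω p c))
    (hvmeas : ∀ k, Measurable (v k))
    (hAmeas : ∀ k, Measurable (fun ω (i j : Fin N) => A k ω i j))
    (hlammeas : ∀ k, Measurable (fun ω (j i : Fin N) => lam k j i ω))
    (hAdiag : ∀ k ω i, A k ω i i = 0)
    (hlamrange : ∀ k j i ω, lam k j i ω ≤ d)
    (hlamdiag : ∀ k i, ∀ᵐ ω ∂μ, lam k i i ω = 0)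
    (hvL2 : ∀ k, Integrable (fun ω => ∑ i, ∑ p, (v k ω i p)^2) μ)
    -- the unknown parameter and the gain sequences
    (x0 : Fin n → ℝ) (a b : ℕ → ℝ)
    -- the estimates generated by the algorithm with delays
    (x : ℤ → Fin N → Ω → Fin n → ℝ)
    (hxinit : ∀ s : ℤ, -(d:ℤ) ≤ s → s ≤ 0 → ∀ i, ∃ c : Fin n → ℝ, ∀ ω, x s i ω = c)
    (hrec : ∀ (k : ℕ) (i : Fin N) (ω : Ω), x ((k:ℤ)+1) i ω = fun p =>
      x (k:ℤ) i ω p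
        + a k * ((H k i ω)ᵀ.mulVec
            (((H k i ω).mulVec x0 + v k ω i) - (H k i ω).mulVec (x (k:ℤ) i ω))) p
        + b k * ∑ j, A k ω i j * (x ((k:ℤ) - (lam k j i ω : ℤ)) j ω p - x (k:ℤ) i ω p))
    -- (A1.a): the noise process is independent of observation matrices, graphs and delays
    (hA1a : ProbabilityTheory.IndepFun
      (fun ω => fun k => v k ω)
      (fun ω => fun k =>
        ((fun (i : Fin N) (p : Fin (ni i)) (c : Fin n) => H k i ω p c),
         (fun (i j : Fin N) => A k ω i j),
         (fun (j i : Fin N) => lam k j i ω))) μ)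
    -- (A1.b)
    (βv : ℝ) (hβv : 0 < βv)
    (hA1b1 : ∀ k i p, (μ[(fun ω => v k ω i p)|sigBeforeD H v A lam k]) =ᵐ[μ] 0)
    (hA1b2 : ∀ k, ∀ᵐ ω ∂μ,
      (μ[(fun ω' => ∑ i, ∑ p, (v k ω' i p)^2)|sigBeforeD H v A lam k]) ω ≤ βv)
    -- (A2.b)
    (βa βH : ℝ) (hβa : 0 < βa) (hβH : 0 < βH)
    (hA2b : ∀ᵐ ω ∂μ, (∀ k i j, |A k ω i j| ≤ βa) ∧ (∀ k i, specNorm (H k i ω) ≤ βH))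
    -- (A3.a)
    (hapos : ∀ k, 0 < a k) (hbpos : ∀ k, 0 < b k)
    (haanti : Antitone a) (hbanti : Antitone b)
    (halim : Tendsto a atTop (𝓝 0)) (hblim : Tendsto b atTop (𝓝 0))
    (haOb : a =O[atTop] b)
    (haOshift : ∀ m : ℕ, 1 ≤ m → a =O[atTop] fun k => a (k + m))
    (hbo : (fun k => (b k)^2) =o[atTop] a)
    (hadiv : Tendsto (fun K => ∑ k ∈ Finset.range K, a k) atTop atTop)
    -- (A3.c)
    (Ca : ℝ) (hCa : ∀ k, a k ≤ Ca * b k)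
    (hA3c : ∃ B : ℝ, (∀ k, b k ≤ B) ∧ ∃ κ : ℝ, 0 < κ ∧ κ < 1 ∧
      B < min (κ / (2 * (N * βa + N * Real.sqrt N * βa + Ca * βH ^ 2)))
        ((1 - (1 - κ)⁻¹) * κ / (2 * N * Real.sqrt N * βa * (1 - (1 - κ) ^ (-(d + 1 : ℤ))))))
    -- the matrices F(k) defined by the delay-elimination recursion
    (F : ℤ → Ω → Matrix (Fin N × Fin n) (Fin N × Fin n) ℝ)
    (hFinit : ∀ k : ℤ, -(d:ℤ) ≤ k → k ≤ -1 → ∀ ω, F k ω = 1)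
    (hFrec : ∀ (k : ℕ) (ω : Ω), F k ω = 1 -
      (b k • (degMat (A k ω) ⊗ₖ (1 : Matrix (Fin n) (Fin n) ℝ))
        + a k • blockHtH (fun i => H k i ω)
        - b k • ∑ q ∈ Finset.range (d+1),
            delayAdj n (A k ω) (fun j i => lam k j i ω) q *
              (phiProdZ (fun t => F t ω) ((k:ℤ) - 1) ((k:ℤ) - q))⁻¹))
    -- the persistence of excitation condition  inf_{m≥0} λ′_m^h ≥ θ > 0  a.s.
    (h : ℕ) (hh : 1 ≤ h) (θ : ℝ) (hθ : 0 < θ)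
    (hpe : ∀ᵐ ω ∂μ, ∀ m : ℕ,
      θ ≤ lambdaMin (∑ k ∈ Finset.Ico (m*h) ((m+1)*h),
        ((2 * (b k / a k)) •
            (cexpM μ (sigBeforeD H v A lam (m*h)) (fun ω' => symmLapl (A k ω')) ω
              ⊗ₖ (1 : Matrix (Fin n) (Fin n) ℝ))
          + (2:ℝ) • cexpM μ (sigBeforeD H v A lam (m*h))
              (fun ω' => blockHtH (fun i => H k i ω')) ω
          - (b k / a k) • ∑ q ∈ Finset.range (d+1),
              cexpM μ (sigBeforeD H v A lam (m*h))
                (fun ω' => delayAdj n (A k ω') (fun j i => lam k j i ω') q *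
                  ((phiProdZ (fun t => F t ω') ((k:ℤ) - 1) ((k:ℤ) - q))⁻¹ - 1)) ω
          - (b k / a k) • ∑ q ∈ Finset.range (d+1),
              cexpM μ (sigBeforeD H v A lam (m*h))
                (fun ω' => ((phiProdZ (fun t => F t ω') ((k:ℤ) - 1) ((k:ℤ) - q))⁻¹ - 1)ᵀ *
                  (delayAdj n (A k ω') (fun j i => lam k j i ω') q)ᵀ) ω))) :
    -- conclusion: mean square convergence at every node
    ∀ i, Tendsto (fun k : ℕ => ∫ ω, ∑ p, (x (k:ℤ) i ω p - x0 p)^2 ∂μ) atTop (𝓝 0) := by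
  obtain ⟨B, hbB, κ, hκ0, hκ1, hB⟩ := hA3c
  have hN0 : (0 : ℝ) < N := by exact_mod_cast hN
  have hCa0 : 0 < Ca := pos_of_mul_pos_left ((hapos 0).trans_le (hCa 0)) (hbpos 0).le
  set cQ : ℝ := N * Real.sqrt N * βa with hcQ
  have hcQ0 : 0 < cQ := by positivity
  rw [show 2 * (N : ℝ) * Real.sqrt N * βa = 2 * cQ by rw [hcQ]; ring] at hB
  have hgain := gain_bounds_of_lt_min hκ0 hκ1 (by positivity : 0 < N * βa) hcQ0
    (by positivity : 0 < Ca * βH ^ 2) hbpos hbB hB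
  have hb0 : ∀ k, 0 ≤ b k := fun k => (hbpos k).le
  have hρ : 1 ≤ (1 - κ)⁻¹ := (one_le_inv₀ (by linarith)).2 (by linarith)
  -- measurability of the entries
  have hHe : ∀ k i p c, Measurable fun ω => H k i ω p c := fun k i p c =>
    (measurable_pi_apply c).comp ((measurable_pi_apply p).comp
      ((measurable_pi_apply i).comp (hHmeas k)))
  have hve : ∀ k i p, Measurable fun ω => v k ω i p := fun k i p =>
    (measurable_pi_apply p).comp ((measurable_pi_apply i).comp (hvmeas k))
  have hAe : ∀ k i j, Measurable fun ω => A k ω i j := fun k i j =>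
    (measurable_pi_apply j).comp ((measurable_pi_apply i).comp (hAmeas k))
  have hlame : ∀ k j i, Measurable (lam k j i) := fun k j i =>
    (measurable_pi_apply i).comp ((measurable_pi_apply j).comp (hlammeas k))
  set P : ℕ → Ω → Matrix (Fin N × Fin n) (Fin N × Fin n) ℝ := fun k ω =>
    b k • (degMat (A k ω) ⊗ₖ (1 : Matrix (Fin n) (Fin n) ℝ))
      + a k • blockHtH (fun i => H k i ω) with hPdef
  set Q : ℕ → ℕ → Ω → Matrix (Fin N × Fin n) (Fin N × Fin n) ℝ := fun k q ω =>
    delayAdj n (A k ω) (fun j i => lam k j i ω) q with hQdef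
  have hPm : ∀ k p r, Measurable fun ω => P k ω p r := fun k p r =>
    ((measurable_kronecker_one_entry (measurable_degMat_entry (hAe k)) p r).const_mul
      (b k)).add ((measurable_blockHtH_entry (hHe k) p r).const_mul (a k))
  have hQm : ∀ k q p r, Measurable fun ω => Q k q ω p r := fun k q =>
    measurable_delayAdj_entry (hAe k) (hlame k) q
  have hFm := measurable_delay_recursion hFinit hFrec hPm hQm
  have hΨm : ∀ (k q : ℕ), q ≤ d → ∀ p r, Measurable fun ω =>
      (phiProdZ (fun t => F t ω) ((k : ℤ) - 1) ((k : ℤ) - q))⁻¹ p r := fun k q hq =>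
    measurable_phiProdZ_inv_entry fun j hj => hFm _ (by omega)
  -- norm bounds
  have hP : ∀ᵐ ω ∂μ, ∀ k, ‖toEuclideanCLM (n := Fin N × Fin n) (𝕜 := ℝ) (P k ω)‖ ≤
      b k * (N * βa + Ca * βH ^ 2) := by
    filter_upwards [hA2b] with ω hω k
    have h1 := norm_degMat_kronecker_le (n := n) hβa.le (hω.1 k)
    have h2 := norm_blockHtH_le (hω.2 k)
    simp only [hPdef, map_add, map_smul]
    refine (norm_add_le _ _).trans ?_
    rw [norm_smul, norm_smul, Real.norm_of_nonneg (hb0 k), Real.norm_of_nonneg (hapos k).le]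
    have h3 := mul_le_mul_of_nonneg_left h1 (hb0 k)
    have h4 := mul_le_mul (hCa k) h2 (norm_nonneg _) (mul_pos hCa0 (hbpos k)).le
    linarith
  have hQ : ∀ᵐ ω ∂μ, ∀ k q, ‖toEuclideanCLM (n := Fin N × Fin n) (𝕜 := ℝ) (Q k q ω)‖ ≤ cQ := by
    filter_upwards [hA2b] with ω hω k q
    exact norm_delayAdj_le hβa.le (hω.1 k) q
  set S : ℝ := ∑ q ∈ Finset.range (d + 1), (1 - κ)⁻¹ ^ q with hS
  have hS0 : 0 ≤ S := Finset.sum_nonneg fun q _ => by positivity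
  have hFb : ∀ᵐ ω ∂μ,
      (∀ k : ℤ, -(d : ℤ) ≤ k →
        ‖toEuclideanCLM (n := Fin N × Fin n) (𝕜 := ℝ) (1 - F k ω)‖ ≤ κ) ∧
      ∀ k : ℕ, ‖toEuclideanCLM (n := Fin N × Fin n) (𝕜 := ℝ) (1 - F k ω)‖ ≤
        (N * βa + Ca * βH ^ 2 + cQ * S) * b k := by
    filter_upwards [hP, hQ] with ω hPω hQω
    exact norm_one_sub_le_of_delay_recursion (F := fun k => F k ω) (P := fun k => P k ω)
      (Q := fun k q => Q k q ω) hκ0.le hκ1 hb0 (fun k h1 h2 => hFinit k h1 h2 ω)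
      (fun k => hFrec k ω) hPω hQω (fun k => (hgain k).1) (fun k => (hgain k).2)
  -- the stacked error and the stacked noise
  set e : ℤ → Ω → EuclideanSpace ℝ (Fin N × Fin n) := fun s ω =>
    stackedError (fun i => x s i ω) x0 with hedef
  set W : ℕ → Ω → EuclideanSpace ℝ (Fin N × Fin n) := fun k ω =>
    stackedNoise (fun i => H k i ω) (v k ω) with hWdef
  have hstep : ∀ (k : ℕ) ω, e ((k : ℤ) + 1) ω = e k ω
      - toEuclideanCLM (n := Fin N × Fin n) (𝕜 := ℝ) (P k ω) (e k ω)
      + b k • ∑ q ∈ Finset.range (d + 1),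
        toEuclideanCLM (n := Fin N × Fin n) (𝕜 := ℝ) (Q k q ω) (e ((k : ℤ) - q) ω)
      + a k • W k ω := fun k ω =>
    stackedError_succ (x := fun s i => x s i ω) (fun j i => hlamrange k j i ω)
      fun i p => congrFun (hrec k i ω) p
  have hv2 : ∀ k i p, MemLp (fun ω => v k ω i p) 2 μ := by
    intro k i p
    rw [memLp_two_iff_integrable_sq (hve k i p).aestronglyMeasurable]
    refine (hvL2 k).mono' ((hve k i p).pow_const 2).aestronglyMeasurable (ae_of_all _ fun ω => ?_)
    rw [Real.norm_of_nonneg (sq_nonneg _)]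
    exact (Finset.single_le_sum (f := fun p => v k ω i p ^ 2) (fun _ _ => sq_nonneg _)
      (Finset.mem_univ p)).trans (Finset.single_le_sum (f := fun i => ∑ p, v k ω i p ^ 2)
        (fun _ _ => Finset.sum_nonneg fun _ _ => sq_nonneg _) (Finset.mem_univ i))
  have hWle : ∀ k, ∀ᵐ ω ∂μ, ‖W k ω‖ ^ 2 ≤ βH ^ 2 * ∑ i, ∑ p, v k ω i p ^ 2 := fun k =>
    hA2b.mono fun ω hω => norm_stackedNoise_sq_le (hω.2 k)
  have hW2 : ∀ k, MemLp (W k) 2 μ := by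
    intro k
    have hWm : Measurable (W k) := measurable_stackedNoise (hHe k) (hve k)
    rw [memLp_two_iff_integrable_sq_norm hWm.aestronglyMeasurable]
    refine ((hvL2 k).const_mul (βH ^ 2)).mono' (hWm.norm.pow_const 2).aestronglyMeasurable
      ((hWle k).mono fun ω hω => ?_)
    rwa [Real.norm_of_nonneg (sq_nonneg _)]
  have he2 : ∀ k : ℕ, ∀ s : ℤ, -(d : ℤ) ≤ s → s ≤ k → MemLp (e s) 2 μ := by
    intro k
    induction k with
    | zero =>
      intro s h1 h2
      choose c hc using hxinit s h1 (by simpa using h2)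
      simp only [hedef, hc]
      exact memLp_const _
    | succ k ih =>
      intro s h1 h2
      rcases (show s ≤ k ∨ s = (k : ℤ) + 1 by push_cast at h2; omega) with h3 | rfl
      · exact ih s h1 h3
      · rw [funext (hstep k)]
        have hek := ih k (by omega) le_rfl
        have hPe := memLp_toEuclideanCLM_apply (hPm k) (hP.mono fun ω hω => hω k) hek
        have hQe : ∀ q ∈ Finset.range (d + 1), MemLp (fun ω =>
            toEuclideanCLM (n := Fin N × Fin n) (𝕜 := ℝ) (Q k q ω) (e ((k : ℤ) - q) ω)) 2 μ := by
          intro q hq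
          have := Finset.mem_range_succ_iff.1 hq
          exact memLp_toEuclideanCLM_apply (hQm k q) (hQ.mono fun ω hω => hω k q)
            (ih _ (by omega) (by omega))
        exact ((hek.sub hPe).add ((memLp_finsetSum _ hQe).const_smul (b k))).add
          ((hW2 k).const_smul (a k))
  have heN : ∀ k : ℕ, MemLp (e k) 2 μ := fun k => he2 k k (by omega) le_rfl
  have heE : ∀ (k : ℕ) ic, MemLp (fun ω => e k ω ic) 2 μ := fun k ic =>
    (EuclideanSpace.proj (𝕜 := ℝ) ic).comp_memLp' (heN k)
  have hGe : ∀ k l : ℕ, MemLp (fun ω =>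
      toEuclideanCLM (n := Fin N × Fin n) (𝕜 := ℝ) (1 - F k ω) (e l ω)) 2 μ := fun k l =>
    memLp_toEuclideanCLM_apply (fun p r => (hFm k (by omega) p r).const_sub _)
      (hFb.mono fun ω hω => hω.1 k (by omega)) (heN l)
  have hGeq : ∀ k : ℕ, ∀ y ω,
      y - toEuclideanCLM (n := Fin N × Fin n) (𝕜 := ℝ) (F k ω) y =
        toEuclideanCLM (n := Fin N × Fin n) (𝕜 := ℝ) (1 - F k ω) y := fun k y ω => by
    simp [map_sub, map_one]
  have hmain := tendsto_integral_norm_sq_zero (μ := μ) (e := fun k => e k)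
    (g := fun k ω => e ((k : ℤ) + 1) ω
      - toEuclideanCLM (n := Fin N × Fin n) (𝕜 := ℝ) (F k ω) (e k ω))
    (w := fun k ω => a k • W k ω)
    (G := fun k ω => toEuclideanCLM (n := Fin N × Fin n) (𝕜 := ℝ) (1 - F k ω))
    (a := a) (b := b) (C := N * βa + Ca * βH ^ 2 + cQ * S) (C₁ := βH ^ 2 * βv) (d := d)
    heN ?_ (fun k => (hW2 k).const_smul (a k))
    (fun l k => integrable_inner_of_memLp (heN l) (hGe k l)) hapos hbpos haanti hbanti halim
    hblim haOshift hbo hadiv (by positivity) (by positivity) hh hθ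
    (hFb.mono fun ω hω => hω.2) ?_ ?_ ?_ ?_ ?_
  · intro i
    refine squeeze_zero (fun k => integral_nonneg fun ω =>
      Finset.sum_nonneg fun p _ => sq_nonneg _) (fun k => ?_) hmain
    refine integral_mono_of_nonneg (ae_of_all _ fun ω =>
      Finset.sum_nonneg fun p _ => sq_nonneg _) (integrable_norm_sq (heN k))
      (ae_of_all _ fun ω => ?_)
    simp only [EuclideanSpace.real_norm_sq_eq, Fintype.sum_prod_type]
    exact Finset.single_le_sum (f := fun i => ∑ p, e k ω (i, p) ^ 2)
      (fun _ _ => Finset.sum_nonneg fun _ _ => sq_nonneg _) (Finset.mem_univ i)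
  · intro k
    have h1 : MemLp (e ((k : ℤ) + 1)) 2 μ := by exact_mod_cast heN (k + 1)
    refine (h1.sub ((heN k).sub (hGe k k))).ae_eq (ae_of_all _ fun ω => ?_)
    simp
  · refine ae_of_all _ fun ω k => ?_
    rw [← hGeq]
    push_cast
    abel
  · filter_upwards [hQ, hFb] with ω hQω hFω k hk
    refine (norm_defect_sub_le (F := fun k => F k ω) (P := fun k => P k ω)
      (Q := fun k q => Q k q ω) (e := fun s => e s ω) hκ0.le hκ1 hb0 (fun k => hFrec k ω) hQω
      hFω.1 (hstep k ω)).trans ?_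
    have hcast : ∀ j ∈ Finset.range d, ((k - (j + 1) : ℕ) : ℤ) = (k : ℤ) - (j + 1) := by
      intro j hj
      have := Finset.mem_range.1 hj
      omega
    refine mul_le_mul ?_ (Finset.sum_le_sum fun j hj => by rw [hcast j hj])
      (Finset.sum_nonneg fun _ _ => norm_nonneg _) (mul_nonneg (by positivity) (hb0 k))
    have : 0 ≤ (N * βa + Ca * βH ^ 2) * b k := mul_nonneg (by positivity) (hb0 k)
    linarith
  · intro k
    have hle := sigBeforeD_le hHmeas hvmeas hAmeas hlammeas k
    have h1 : ∫ ω, ∑ i, ∑ p, v k ω i p ^ 2 ∂μ ≤ βv := by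
      rw [← integral_condExp hle]
      exact (integral_mono_ae integrable_condExp (integrable_const βv) (hA1b2 k)).trans_eq
        (by simp)
    have h2 : ∫ ω, ‖W k ω‖ ^ 2 ∂μ ≤ βH ^ 2 * βv := by
      refine (integral_mono_ae (integrable_norm_sq (hW2 k)) ((hvL2 k).const_mul _)
        (hWle k)).trans ?_
      rw [integral_const_mul]
      exact mul_le_mul_of_nonneg_left h1 (sq_nonneg _)
    simp only [norm_smul, mul_pow, Real.norm_eq_abs, sq_abs]
    rw [integral_const_mul, mul_comm]
    exact mul_le_mul_of_nonneg_right h2 (sq_nonneg _)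
  · intro l k hlk
    simp only [inner_smul_right]
    rw [integral_const_mul, integral_inner_stackedError_stackedNoise_eq_zero hHmeas hvmeas
      hAmeas hlammeas hA1a hA1b1 hβH.le (hA2b.mono fun ω hω => hω.2 k) (hv2 k)
      (fun i c => measurable_estimate hlamrange hxinit hrec k l (by omega)
        (by exact_mod_cast hlk) i c) (fun i c => heE l (i, c)), mul_zero]
  · intro m
    have hexc := mul_integral_sum_sq_le_of_excitation
      (sigBeforeD_le hHmeas hvmeas hAmeas hlammeas (m * h)) (d := d)
      (y := fun ω => (e ((m * h : ℕ) : ℤ) ω).ofLp)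
      (L := fun k ω => blockHtH fun i => H k i ω)
      (Ψ := fun k q ω => (phiProdZ (fun t => F t ω) ((k : ℤ) - 1) ((k : ℤ) - q))⁻¹)
      (fun ic => (measurable_estimate hlamrange hxinit hrec (m * h) (m * h : ℕ) (by omega)
        le_rfl ic.1 ic.2).sub_const _) (heE (m * h)) hAe hlame hlamrange
      (fun k => measurable_blockHtH_entry (hHe k)) hΨm (hA2b.mono fun ω hω => hω.1)
      (cL := βH ^ 2) (hA2b.mono fun ω hω k p q =>
        (abs_entry_le_norm _ p q).trans (norm_blockHtH_le (hω.2 k)))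
      (cΨ := cQ * ((1 - κ)⁻¹ ^ d + 1)) ?_ (fun k => (hapos k).ne') hθ
      (hpe.mono fun ω hω => hω m)
    · rw [Finset.sum_Ico_eq_sum_range, show (m + 1) * h - m * h = h by
        rw [add_mul, one_mul, Nat.add_sub_cancel_left]] at hexc
      simp only [EuclideanSpace.real_norm_sq_eq]
      refine hexc.trans_eq (Finset.sum_congr rfl fun j _ => ?_)
      simp only [inner_toEuclideanCLM_self, hFrec, sub_sub_cancel]
      rw [div_mul_eq_mul_div]
    · filter_upwards [hQ, hFb] with ω hQω hFω k q hq p r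
      refine (abs_entry_le_norm _ p r).trans ?_
      exact norm_mul_sub_one_le (hQω k q) ((norm_phiProdZ_inv_le (F := fun t => F t ω) hκ1
        fun j hj => hFω.1 _ (by omega)).trans (pow_le_pow_right₀ hρ hq))
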